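/- arXiv:1808.04275 — 8 statements merged into one kernel-verified Lean document; each statement's English description precedes it below -/
import Mathlib

section
/- For every integer n ≥ 1: every T ∈ T_n^o has exactly one empty row, which lies among the rows n+1,…,2n+1; deleting this empty row (i.e., replacing each point (j,i) with i greater than the index of the empty row by (j,i−1)) yields an element φ(T) of T_n^e; the resulting map φ : T_n^o → T_n^e is surjective and every fiber of φ has exactly n+1 elements; consequently 2^n·|T_n^o| = ((n+1)!)^2. -/
open scoped Classical

namespace SymDellac

/-- The polynomials `P n` (for `n ≥ 1`) defined by `P 1 = 1` and
`P (n+1) (x) = ((x+2)(x+1)/2) P n (x+2) - (x(x-1)/2) P n (x)`. -/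
noncomputable def P : ℕ → Polynomial ℚ
  | 0 => 1
  | 1 => 1
  | n + 2 =>
      Polynomial.C (1/2 : ℚ) *
        ((Polynomial.X + 2) * (Polynomial.X + 1) * ((P (n+1)).comp (Polynomial.X + 2))
          - Polynomial.X * (Polynomial.X - 1) * (P (n+1)))

/-- The polynomials `D n` defined by `D 0 = 1` and
`D (n+1) (x) = (x+1)(x+2) D n (x+2) - x(x+1) D n (x)`. -/
noncomputable def D : ℕ → Polynomial ℚ
  | 0 => 1
  | n + 1 =>
      (Polynomial.X + 1) * (Polynomial.X + 2) * ((D n).comp (Polynomial.X + 2))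
        - Polynomial.X * (Polynomial.X + 1) * (D n)

/-! ### Even extended Dellac configurations -/

/-- `T` is an even extended Dellac configuration of size `n`. -/
def IsTne (n : ℕ) (T : Finset (ℕ × ℕ)) : Prop :=
  (∀ p ∈ T, 1 ≤ p.1 ∧ p.1 ≤ n ∧ 1 ≤ p.2 ∧ p.2 ≤ 2*n ∧ p.1 ≤ p.2) ∧
  (∀ i ∈ Finset.Icc 1 (2*n), (T.filter (fun p => p.2 = i)).card = 1) ∧
  (∀ j ∈ Finset.Icc 1 n, (T.filter (fun p => p.1 = j)).card = 2)

/-- The finite set of even extended Dellac configurations of size `n`. -/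
noncomputable def TneF (n : ℕ) : Finset (Finset (ℕ × ℕ)) :=
  ((Finset.Icc 1 n ×ˢ Finset.Icc 1 (2*n)).powerset).filter (IsTne n)

/-- Number of free points of an even extended Dellac configuration. -/
def frE (n : ℕ) (T : Finset (ℕ × ℕ)) : ℕ :=
  (T.filter (fun p => 2*n + 1 ≤ p.2 + p.1)).card

/-- The (unique) point of `T` in row `r` (junk value if there is none). -/
noncomputable def rowPt (T : Finset (ℕ × ℕ)) (r : ℕ) : ℕ × ℕ :=
  if h : ∃ p ∈ T, p.2 = r then h.choose else (0, 0)

/-- `p` is the upper of the two points of its column in `T`. -/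
def IsUpper (T : Finset (ℕ × ℕ)) (p : ℕ × ℕ) : Prop :=
  ∃ q ∈ T, q.1 = p.1 ∧ q.2 < p.2

/-- One step of the path of Definition 1.2 (even case). -/
noncomputable def stepE (n : ℕ) (T : Finset (ℕ × ℕ)) (p : ℕ × ℕ) : ℕ × ℕ :=
  if p.1 = n then p
  else if IsUpper T p then rowPt T (2*n - p.1) else rowPt T p.1

/-- The path `(p_0, p_1, …)` starting at the point of row `i` (even case). -/
noncomputable def pathE (n : ℕ) (T : Finset (ℕ × ℕ)) (i k : ℕ) : ℕ × ℕ :=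
  (stepE n T)^[k] (rowPt T i)

/-- The set of points of the subsequence `S_T(i)` of strict column records. -/
noncomputable def recSetE (n : ℕ) (T : Finset (ℕ × ℕ)) (i : ℕ) : Set (ℕ × ℕ) :=
  {p | ∃ k, pathE n T i k = p ∧ ∀ k' < k, (pathE n T i k').1 < p.1}

/-- `b(T)`: `B(T) = S_T(n)` has `b(T) + 1` elements. -/
noncomputable def bStat (n : ℕ) (T : Finset (ℕ × ℕ)) : ℕ := (recSetE n T n).ncard - 1

/-- `r(T)`: `R(T) = S_T(2n)` has `r(T) + 1` elements. -/
noncomputable def rStat (n : ℕ) (T : Finset (ℕ × ℕ)) : ℕ := (recSetE n T (2*n)).ncard - 1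

/-- Row of the upper point of column `c` of `T`. -/
noncomputable def upRow (T : Finset (ℕ × ℕ)) (c : ℕ) : ℕ := sSup {i | (c, i) ∈ T}

/-- Row of the lower point of column `c` of `T`. -/
noncomputable def lowRow (T : Finset (ℕ × ℕ)) (c : ℕ) : ℕ := sInf {i | (c, i) ∈ T}

/-- One step of the root sequence `I_T(j,i)`, in a tableau with `R` rows. -/
noncomputable def rStep (R j : ℕ) (T : Finset (ℕ × ℕ)) (x : ℕ) : ℕ :=
  if (j ≤ x ∧ x ≤ R - j) ∨ x = R then x
  else if R - j + 1 ≤ x ∧ x ≤ R - 1 then upRow T (R - x)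
  else lowRow T x

/-- `root_T(j,i)`: the eventual constant value of the sequence `I_T(j,i)`
(junk value `0` if the sequence is not eventually constant). -/
noncomputable def rootVal (R j : ℕ) (T : Finset (ℕ × ℕ)) (i : ℕ) : ℕ :=
  if h : ∃ v, ∃ N, ∀ k ≥ N, (rStep R j T)^[k] i = v then h.choose else 0

/-- The set `G(T)` for an even extended Dellac configuration. -/
noncomputable def GsetE (n : ℕ) (T : Finset (ℕ × ℕ)) : Set (ℕ × ℕ) :=
  {p | p ∈ T ∧ 2*n + 1 ≤ p.2 + p.1 ∧
    (∃ q ∈ T, q.1 = p.1 ∧ q ≠ p ∧ q ∈ recSetE n T n) ∧ rootVal (2*n) p.1 T p.2 = p.1}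

/-- `g(T) = |G(T)|`. -/
noncomputable def gStat (n : ℕ) (T : Finset (ℕ × ℕ)) : ℕ := (GsetE n T).ncard

/-- `max(T) = b(T) + r(T) + g(T)`. -/
noncomputable def maxStat (n : ℕ) (T : Finset (ℕ × ℕ)) : ℕ :=
  bStat n T + rStat n T + gStat n T

/-! ### Odd extended Dellac configurations -/

/-- `T` is an odd extended Dellac configuration of size `n`. -/
def IsTno (n : ℕ) (T : Finset (ℕ × ℕ)) : Prop :=
  (∀ p ∈ T, 1 ≤ p.1 ∧ p.1 ≤ n ∧ 1 ≤ p.2 ∧ p.2 ≤ 2*n+1 ∧ p.1 ≤ p.2) ∧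
  (∀ i : ℕ, (T.filter (fun p => p.2 = i)).card ≤ 1) ∧
  (∀ i ∈ Finset.Icc 1 n, (T.filter (fun p => p.2 = i)).card = 1) ∧
  (∀ j ∈ Finset.Icc 1 n, (T.filter (fun p => p.1 = j)).card = 2)

/-- The finite set of odd extended Dellac configurations of size `n`. -/
noncomputable def TnoF (n : ℕ) : Finset (Finset (ℕ × ℕ)) :=
  ((Finset.Icc 1 n ×ˢ Finset.Icc 1 (2*n+1)).powerset).filter (IsTno n)

/-- Number of free points of an odd extended Dellac configuration. -/
def frO (n : ℕ) (T : Finset (ℕ × ℕ)) : ℕ :=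
  (T.filter (fun p => 2*n + 2 ≤ p.2 + p.1)).card

/-- One step of the path (odd case): if the required row is empty, stay put. -/
noncomputable def stepO (n : ℕ) (T : Finset (ℕ × ℕ)) (p : ℕ × ℕ) : ℕ × ℕ :=
  if p.1 = n then p
  else
    let r : ℕ := if IsUpper T p then 2*n + 1 - p.1 else p.1
    if ∃ q ∈ T, q.2 = r then rowPt T r else p

/-- The path `(p_0, p_1, …)` starting at the point of row `i` (odd case). -/
noncomputable def pathO (n : ℕ) (T : Finset (ℕ × ℕ)) (i k : ℕ) : ℕ × ℕ :=
  (stepO n T)^[k] (rowPt T i)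

/-- The set of points of `V(T) = S_T(2n+1)` (empty if row `2n+1` is empty). -/
noncomputable def Vset (n : ℕ) (T : Finset (ℕ × ℕ)) : Set (ℕ × ℕ) :=
  if ∃ p ∈ T, p.2 = 2*n + 1 then
    {p | ∃ k, pathO n T (2*n+1) k = p ∧ ∀ k' < k, (pathO n T (2*n+1) k').1 < p.1}
  else ∅

/-- `v(T)`: the number of elements of `V(T)`. -/
noncomputable def vStat (n : ℕ) (T : Finset (ℕ × ℕ)) : ℕ := (Vset n T).ncard

/-- The set `G(T)` for an odd extended Dellac configuration. -/
noncomputable def GsetO (n : ℕ) (T : Finset (ℕ × ℕ)) : Set (ℕ × ℕ) :=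
  {p | p ∈ T ∧ 2*n + 2 ≤ p.2 + p.1 ∧
    (∃ q ∈ T, q.1 = p.1 ∧ q ≠ p ∧ q ∈ Vset n T) ∧ rootVal (2*n+1) p.1 T p.2 = p.1}

/-- `g(T) = |G(T)|` (odd case). -/
noncomputable def gStatO (n : ℕ) (T : Finset (ℕ × ℕ)) : ℕ := (GsetO n T).ncard

/-! ### Dellac configurations and symmetric Dellac configurations -/

/-- `D` is a Dellac configuration of size `N`. -/
def IsDC (N : ℕ) (D : Finset (ℕ × ℕ)) : Prop :=
  (∀ p ∈ D, 1 ≤ p.1 ∧ p.1 ≤ N ∧ 1 ≤ p.2 ∧ p.2 ≤ 2*N ∧ p.1 ≤ p.2 ∧ p.2 ≤ N + p.1) ∧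
  (∀ i ∈ Finset.Icc 1 (2*N), (D.filter (fun p => p.2 = i)).card = 1) ∧
  (∀ j ∈ Finset.Icc 1 N, (D.filter (fun p => p.1 = j)).card = 2)

/-- `D` is a symmetric Dellac configuration of size `N`. -/
def IsSDC (N : ℕ) (D : Finset (ℕ × ℕ)) : Prop :=
  IsDC N D ∧ ∀ p ∈ D, (N + 1 - p.1, 2*N + 1 - p.2) ∈ D

/-- The finite set of symmetric Dellac configurations of size `N`. -/
noncomputable def SDCF (N : ℕ) : Finset (Finset (ℕ × ℕ)) :=
  ((Finset.Icc 1 N ×ˢ Finset.Icc 1 (2*N)).powerset).filter (IsSDC N)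

/-! ### Surjective pistols -/

/-- `p` encodes a surjective pistol of size `n`: position `k` stands for `k+1 ∈ {1,…,2n}`
and value `p k` stands for `(p k) + 1 ∈ {2,4,…,2n}`. -/
def IsSP (n : ℕ) (p : Fin (2*n) → Fin (2*n)) : Prop :=
  (∀ k, Even ((p k : ℕ) + 1) ∧ (k : ℕ) ≤ (p k : ℕ)) ∧
  (∀ m : Fin (2*n), Even ((m : ℕ) + 1) → ∃ k, p k = m)

/-- The finite set of surjective pistols of size `n`. -/
noncomputable def SPF (n : ℕ) : Finset (Fin (2*n) → Fin (2*n)) :=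
  Finset.univ.filter (IsSP n)

/-- `max(f)`: the number of `j ∈ {1,…,2n-2}` with `f(j) = 2n`. -/
noncomputable def maxP (n : ℕ) (p : Fin (2*n) → Fin (2*n)) : ℕ :=
  (Finset.univ.filter (fun k : Fin (2*n) => (k : ℕ) + 1 ≤ 2*n - 2 ∧ (p k : ℕ) + 1 = 2*n)).card

/-- `fd(f)`: the number of doubled fixed points of `f`. -/
noncomputable def fdP (n : ℕ) (p : Fin (2*n) → Fin (2*n)) : ℕ :=
  (Finset.univ.filter (fun k : Fin (2*n) =>
    (k : ℕ) + 1 ≤ 2*n - 2 ∧ (p k : ℕ) = (k : ℕ) ∧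
      ∃ k' : Fin (2*n), (k' : ℕ) < (k : ℕ) ∧ p k' = p k)).card

end SymDellac
/-! ### More constructions -/

namespace SymDellac

/-- `e_{n,k} = Σ_{T ∈ T_n^e, max(T) = k} 2^{fr(T) - 1 - k}`. -/
noncomputable def eStat (n k : ℕ) : ℕ :=
  ∑ T ∈ (TneF n).filter (fun T => maxStat n T = k), 2 ^ (frE n T - 1 - k)

/-- The configuration `T_{n,max}` with points `(j,j)` and `(j, 2n+1-j)` for `j ∈ [n]`. -/
def Tmax (n : ℕ) : Finset (ℕ × ℕ) :=
  (Finset.Icc 1 n).image (fun j => (j, j)) ∪ (Finset.Icc 1 n).image (fun j => (j, 2*n + 1 - j))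

/-- The index of the (unique) empty row of an odd extended Dellac configuration. -/
noncomputable def emptyRowIdx (n : ℕ) (T : Finset (ℕ × ℕ)) : ℕ :=
  sInf {i | 1 ≤ i ∧ i ≤ 2*n + 1 ∧ ∀ p ∈ T, p.2 ≠ i}

/-- The map `φ : T_n^o → T_n^e` deleting the empty row. -/
noncomputable def phi (n : ℕ) (T : Finset (ℕ × ℕ)) : Finset (ℕ × ℕ) :=
  T.image (fun p => if emptyRowIdx n T < p.2 then (p.1, p.2 - 1) else p)

/-- `Omax(T)`: the set of all points of `B(T)`, `R(T)` and `G(T)`. -/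
noncomputable def OmaxE (n : ℕ) (T : Finset (ℕ × ℕ)) : Set (ℕ × ℕ) :=
  recSetE n T n ∪ recSetE n T (2*n) ∪ GsetE n T

/-- Insertion of a point in the box `(j, r)` of a tableau `U` with `R` rows:
add the point `(j, i₀)` where `i₀` is the (unique) row with no point of `U`
in columns `1,…,j-1` whose root equals `r`. -/
noncomputable def insertPt (R j r : ℕ) (U : Finset (ℕ × ℕ)) : Finset (ℕ × ℕ) :=
  if h : ∃ i0, j ≤ i0 ∧ i0 ≤ R ∧ (∀ p ∈ U, p.2 = i0 → j ≤ p.1) ∧ rootVal R j U i0 = r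
  then insert (j, h.choose) U else U

/-- One step (column `j`) of the construction of `P(T)`. -/
noncomputable def Pstep (n : ℕ) (T : Finset (ℕ × ℕ)) (U : Finset (ℕ × ℕ)) (j : ℕ) :
    Finset (ℕ × ℕ) :=
  let U1 := if ∃ p ∈ T, p.1 = j ∧ p ∈ recSetE n T n ∪ recSetE n T (2*n)
    then insertPt (2*n - 1) j (2*n - 1) U else U
  if ∃ p ∈ T, p.1 = j ∧ p ∈ GsetE n T then insertPt (2*n - 1) j j U1 else U1

/-- The map `P : T_n^e → T_{n-1}^o`. -/
noncomputable def Pmap (n : ℕ) (T : Finset (ℕ × ℕ)) : Finset (ℕ × ℕ) :=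
  (List.range' 1 (n-1)).foldl (Pstep n T)
    ((T.filter (fun p => p ∉ OmaxE n T)).image
      (fun p => (p.1, if p.2 < n then p.2 else p.2 - 1)))

end SymDellac

namespace SymDellac

/-- `T` has columns `1,…,m`, each with exactly two points, and exactly one point in each row
of `R`, all points `(j,i)` satisfying `j ≤ i`. -/
def IsRowConfig (m : ℕ) (R : Finset ℕ) (T : Finset (ℕ × ℕ)) : Prop :=
  (∀ p ∈ T, 1 ≤ p.1 ∧ p.1 ≤ m ∧ p.2 ∈ R ∧ p.1 ≤ p.2) ∧
  (∀ i ∈ R, (T.filter (fun p => p.2 = i)).card = 1) ∧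
  (∀ j ∈ Finset.Icc 1 m, (T.filter (fun p => p.1 = j)).card = 2)

/-- The finite set of configurations with `m` columns and set of rows `R`. -/
noncomputable def rowConfigs (m : ℕ) (R : Finset ℕ) : Finset (Finset (ℕ × ℕ)) :=
  ((Finset.Icc 1 m ×ˢ R).powerset).filter (IsRowConfig m R)

lemma mem_rowConfigs {m : ℕ} {R : Finset ℕ} {T : Finset (ℕ × ℕ)} :
    T ∈ rowConfigs m R ↔ IsRowConfig m R T := by
  simp only [rowConfigs, Finset.mem_filter, Finset.mem_powerset, and_iff_right_iff_imp]
  intro h p hp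
  obtain ⟨h1, h2, h3, -⟩ := h.1 p hp
  simp [h1, h2, h3]

lemma mem_TnoF {n : ℕ} {T : Finset (ℕ × ℕ)} : T ∈ TnoF n ↔ IsTno n T := by
  simp only [TnoF, Finset.mem_filter, Finset.mem_powerset, and_iff_right_iff_imp]
  intro h p hp
  obtain ⟨h1, h2, h3, h4, -⟩ := h.1 p hp
  simp [h1, h2, h3, h4]

lemma TneF_eq_rowConfigs (n : ℕ) : TneF n = rowConfigs n (Finset.Icc 1 (2 * n)) := by
  ext T
  rw [mem_rowConfigs]
  simp only [TneF, Finset.mem_filter, Finset.mem_powerset]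
  constructor
  · rintro ⟨-, h, h'⟩
    refine ⟨fun p hp => ?_, h'⟩
    have := h p hp
    simp only [Finset.mem_Icc]
    omega
  · rintro ⟨h, h'⟩
    have h0 : ∀ p ∈ T, 1 ≤ p.1 ∧ p.1 ≤ n ∧ 1 ≤ p.2 ∧ p.2 ≤ 2 * n ∧ p.1 ≤ p.2 := by
      intro p hp
      have := h p hp
      simp only [Finset.mem_Icc] at this
      omega
    refine ⟨fun p hp => ?_, h0, h'⟩
    have := h0 p hp
    simp only [Finset.mem_product, Finset.mem_Icc]
    omega

/-- The rows of the points of `T` in column `j`. -/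
def colRows (j : ℕ) (T : Finset (ℕ × ℕ)) : Finset ℕ :=
  (T.filter (fun p => p.1 = j)).image Prod.snd

lemma mem_colRows {j i : ℕ} {T : Finset (ℕ × ℕ)} : i ∈ colRows j T ↔ (j, i) ∈ T := by
  simp [colRows]

lemma card_colRows (j : ℕ) (T : Finset (ℕ × ℕ)) :
    (colRows j T).card = (T.filter (fun p => p.1 = j)).card := by
  apply Finset.card_image_of_injOn
  rintro ⟨a, b⟩ h ⟨c, d⟩ h' e
  simp only [Finset.coe_filter, Set.mem_ofPred_eq] at h h' e
  simp [h.2, h'.2, e]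

lemma IsRowConfig.eq_of_mem {m : ℕ} {R : Finset ℕ} {T : Finset (ℕ × ℕ)}
    (h : IsRowConfig m R T) {j k i : ℕ} (hj : (j, i) ∈ T) (hk : (k, i) ∈ T) : j = k := by
  have h1 := Finset.card_le_one.1 (h.2.1 i (h.1 _ hj).2.2.1).le (j, i) (by simp [hj])
    (k, i) (by simp [hk])
  exact congrArg Prod.fst h1

lemma IsRowConfig.erase_last {m : ℕ} {R : Finset ℕ} {T : Finset (ℕ × ℕ)}
    (h : IsRowConfig (m + 1) R T) :
    IsRowConfig m (R \ colRows (m + 1) T) (T.filter (fun p => p.1 ≠ m + 1)) := by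
  refine ⟨?_, ?_, ?_⟩
  · rintro ⟨j, i⟩ hp
    simp only [Finset.mem_filter] at hp
    have h1 := h.1 _ hp.1
    refine ⟨h1.1, by have := h1.2.1; have := hp.2; simp only at *; omega, ?_, h1.2.2.2⟩
    rw [Finset.mem_sdiff, mem_colRows]
    exact ⟨h1.2.2.1, fun hm => hp.2 (h.eq_of_mem hp.1 hm)⟩
  · intro i hi
    rw [Finset.mem_sdiff, mem_colRows] at hi
    refine Eq.trans ?_ (h.2.1 i hi.1)
    rw [Finset.filter_filter]
    congr 1
    apply Finset.filter_congr
    rintro ⟨a, b⟩ hp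
    simp only [and_iff_right_iff_imp]
    rintro rfl rfl
    exact hi.2 hp
  · intro j hj
    rw [Finset.mem_Icc] at hj
    rw [← h.2.2 j (Finset.mem_Icc.2 (by omega)), Finset.filter_filter]
    congr 1
    apply Finset.filter_congr
    rintro ⟨a, b⟩ -
    simp only [and_iff_right_iff_imp]
    omega

lemma IsRowConfig.union_last {m : ℕ} {R S : Finset ℕ} {T : Finset (ℕ × ℕ)}
    (hS : S ⊆ R) (hSm : ∀ i ∈ S, m + 1 ≤ i) (hS2 : S.card = 2)
    (h : IsRowConfig m (R \ S) T) :
    IsRowConfig (m + 1) R (T ∪ {m + 1} ×ˢ S) := by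
  refine ⟨?_, ?_, ?_⟩
  · rintro ⟨j, i⟩ hp
    simp only [Finset.mem_union, Finset.mem_product, Finset.mem_singleton] at hp
    rcases hp with hp | ⟨rfl, hp⟩
    · have h1 := h.1 _ hp
      rw [Finset.mem_sdiff] at h1
      exact ⟨h1.1, by omega, h1.2.2.1.1, h1.2.2.2⟩
    · exact ⟨by simp, le_rfl, hS hp, hSm i hp⟩
  · intro i hi
    by_cases hiS : i ∈ S
    · rw [Finset.card_eq_one]
      refine ⟨(m + 1, i), ?_⟩
      ext ⟨a, b⟩
      simp only [Finset.mem_filter, Finset.mem_union, Finset.mem_product, Finset.mem_singleton,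
        Prod.mk.injEq]
      constructor
      · rintro ⟨hp | ⟨rfl, hp⟩, rfl⟩
        · exact absurd hiS (Finset.mem_sdiff.1 (h.1 _ hp).2.2.1).2
        · simp
      · rintro ⟨rfl, rfl⟩
        simp [hiS]
    · rw [← h.2.1 i (Finset.mem_sdiff.2 ⟨hi, hiS⟩)]
      congr 1
      ext ⟨a, b⟩
      simp only [Finset.mem_filter, Finset.mem_union, Finset.mem_product, Finset.mem_singleton]
      constructor
      · rintro ⟨hp | ⟨rfl, hp⟩, rfl⟩
        · exact ⟨hp, rfl⟩
        · exact absurd hp hiS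
      · rintro ⟨hp, rfl⟩
        exact ⟨Or.inl hp, rfl⟩
  · intro j hj
    rw [Finset.mem_Icc] at hj
    rcases eq_or_ne j (m + 1) with rfl | hne
    · rw [← card_colRows, ← hS2]
      congr 1
      ext i
      rw [mem_colRows]
      simp only [Finset.mem_union, Finset.mem_product, Finset.mem_singleton, true_and,
        or_iff_right_iff_imp]
      intro hp
      have := (h.1 _ hp).2.1
      simp only at this
      omega
    · rw [← h.2.2 j (Finset.mem_Icc.2 (by omega))]
      congr 1
      ext ⟨a, b⟩
      simp only [Finset.mem_filter, Finset.mem_union, Finset.mem_product, Finset.mem_singleton]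
      constructor
      · rintro ⟨hp | ⟨rfl, hp⟩, rfl⟩
        · exact ⟨hp, rfl⟩
        · exact absurd rfl hne
      · rintro ⟨hp, rfl⟩
        exact ⟨Or.inl hp, rfl⟩

lemma card_rowConfigs_colRows {m : ℕ} {R S : Finset ℕ}
    (hS : S ⊆ R) (hSm : ∀ i ∈ S, m + 1 ≤ i) (hS2 : S.card = 2) :
    ((rowConfigs (m + 1) R).filter (fun T => colRows (m + 1) T = S)).card =
      (rowConfigs m (R \ S)).card := by
  refine Finset.card_nbij' (fun T => T.filter (fun p => p.1 ≠ m + 1))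
    (fun T => T ∪ {m + 1} ×ˢ S) ?_ ?_ ?_ ?_
  · intro T hT
    simp only [Finset.coe_filter, Set.mem_ofPred_eq, mem_rowConfigs] at hT
    simp only [Finset.mem_coe, mem_rowConfigs]
    rw [← hT.2]
    exact hT.1.erase_last
  · intro T hT
    simp only [Finset.mem_coe, mem_rowConfigs] at hT
    simp only [Finset.coe_filter, Set.mem_ofPred_eq, mem_rowConfigs]
    refine ⟨hT.union_last hS hSm hS2, ?_⟩
    ext i
    rw [mem_colRows]
    simp only [Finset.mem_union, Finset.mem_product, Finset.mem_singleton, true_and,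
      or_iff_right_iff_imp]
    intro hp
    have := (hT.1 _ hp).2.1
    simp only at this
    omega
  · intro T hT
    simp only [Finset.coe_filter, Set.mem_ofPred_eq] at hT
    obtain ⟨-, rfl⟩ := hT
    ext ⟨a, b⟩
    simp only [Finset.mem_filter, Finset.mem_union, Finset.mem_product, Finset.mem_singleton,
      mem_colRows]
    constructor
    · rintro (⟨hp, -⟩ | ⟨rfl, hp⟩) <;> exact hp
    · intro hp
      by_cases ha : a = m + 1
      · subst ha
        exact Or.inr ⟨rfl, hp⟩
      · exact Or.inl ⟨hp, ha⟩
  · intro T hT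
    simp only [Finset.mem_coe, mem_rowConfigs] at hT
    ext ⟨a, b⟩
    simp only [Finset.mem_filter, Finset.mem_union, Finset.mem_product, Finset.mem_singleton]
    constructor
    · rintro ⟨hp | ⟨rfl, hp⟩, hne⟩
      · exact hp
      · exact absurd rfl hne
    · intro hp
      have := (hT.1 _ hp).2.1
      simp only at this
      exact ⟨Or.inl hp, by omega⟩

theorem two_pow_mul_card_rowConfigs (m : ℕ) (R : Finset ℕ) (hR : R.card = 2 * m)
    (hsub : Finset.Icc 1 m ⊆ R) (hpos : ∀ i ∈ R, 1 ≤ i) :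
    2 ^ m * (rowConfigs m R).card = m.factorial * (m + 1).factorial := by
  induction m generalizing R with
  | zero =>
    obtain rfl : R = ∅ := by simpa using hR
    have : rowConfigs 0 ∅ = {∅} := by
      ext T
      rw [mem_rowConfigs, Finset.mem_singleton]
      constructor
      · intro h
        exact Finset.eq_empty_of_forall_notMem fun p hp => absurd (h.1 p hp).2.2.1 (by simp)
      · rintro rfl
        simp [IsRowConfig]
    simp [this]
  | succ m ih =>
    set A := R.filter (fun i => m + 1 ≤ i) with hA
    have hAcard : A.card = m + 2 := by
      have h1 : A = R \ Finset.Icc 1 m := by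
        ext i
        simp only [hA, Finset.mem_filter, Finset.mem_sdiff, Finset.mem_Icc]
        constructor
        · rintro ⟨h, h'⟩
          exact ⟨h, by omega⟩
        · rintro ⟨h, h'⟩
          have := hpos i h
          exact ⟨h, by omega⟩
      rw [h1, Finset.card_sdiff_of_subset
        ((Finset.Icc_subset_Icc_right (Nat.le_succ m)).trans hsub), hR, Nat.card_Icc]
      omega
    have hmaps : ∀ T ∈ rowConfigs (m + 1) R, colRows (m + 1) T ∈ A.powersetCard 2 := by
      intro T hT
      rw [mem_rowConfigs] at hT
      rw [Finset.mem_powersetCard, card_colRows]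
      refine ⟨fun i hi => ?_, hT.2.2 _ (by simp)⟩
      have := hT.1 _ (mem_colRows.1 hi)
      exact Finset.mem_filter.2 ⟨this.2.2.1, this.2.2.2⟩
    rw [Finset.card_eq_sum_card_fiberwise hmaps, Finset.mul_sum,
      Finset.sum_congr rfl (g := fun _ => 2 * (m.factorial * (m + 1).factorial)),
      Finset.sum_const, Finset.card_powersetCard, hAcard, smul_eq_mul]
    · have h3 : (m + 2).choose 2 * 2 = (m + 2) * (m + 1) := by
        rw [Nat.choose_two_right]
        exact Nat.div_mul_cancel (Nat.even_mul_pred_self (m + 2)).two_dvd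
      rw [← mul_assoc, h3, Nat.factorial_succ (m + 1), Nat.factorial_succ m]
      ring
    · intro S hS
      rw [Finset.mem_powersetCard] at hS
      have hSR : S ⊆ R := hS.1.trans (Finset.filter_subset _ _)
      have hSm : ∀ i ∈ S, m + 1 ≤ i := fun i hi => (Finset.mem_filter.1 (hS.1 hi)).2
      rw [card_rowConfigs_colRows hSR hSm hS.2, pow_succ', mul_assoc, ih]
      · rw [Finset.card_sdiff_of_subset hSR, hR, hS.2]
        omega
      · intro i hi
        rw [Finset.mem_Icc] at hi
        refine Finset.mem_sdiff.2 ⟨hsub (Finset.mem_Icc.2 (by omega)), fun h => ?_⟩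
        have := hSm i h
        omega
      · exact fun i hi => hpos i (Finset.sdiff_subset hi)

lemma IsRowConfig.image {m : ℕ} {R : Finset ℕ} {T : Finset (ℕ × ℕ)} (h : IsRowConfig m R T)
    {f : ℕ → ℕ} (hf : Set.InjOn f R) (hle : ∀ i ∈ R, ∀ j ≤ m, j ≤ i → j ≤ f i) :
    IsRowConfig m (R.image f) (T.image (Prod.map id f)) := by
  have hinj : Set.InjOn (Prod.map id f : ℕ × ℕ → ℕ × ℕ) T := by
    rintro ⟨a, b⟩ hp ⟨c, d⟩ hq heq
    simp only [Prod.map, id, Prod.mk.injEq] at heq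
    exact Prod.ext heq.1 (hf (h.1 _ hp).2.2.1 (h.1 _ hq).2.2.1 heq.2)
  refine ⟨?_, ?_, ?_⟩
  · intro p hp
    obtain ⟨q, hq, rfl⟩ := Finset.mem_image.1 hp
    obtain ⟨h1, h2, h3, h4⟩ := h.1 q hq
    exact ⟨h1, h2, Finset.mem_image_of_mem f h3, hle _ h3 _ h2 h4⟩
  · intro i hi
    obtain ⟨k, hk, rfl⟩ := Finset.mem_image.1 hi
    rw [← h.2.1 k hk, Finset.filter_image, Finset.card_image_of_injOn
      (hinj.mono (Finset.coe_subset.2 (Finset.filter_subset _ _)))]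
    congr 1
    apply Finset.filter_congr
    intro q hq
    exact hf.eq_iff (h.1 q hq).2.2.1 hk
  · intro j hj
    rw [← h.2.2 j hj, Finset.filter_image, Finset.card_image_of_injOn
      (hinj.mono (Finset.coe_subset.2 (Finset.filter_subset _ _)))]
    rfl

/-- Every odd extended Dellac configuration misses exactly one of the rows `1,…,2n+1`. -/
lemma IsTno.exists_isRowConfig {n : ℕ} {T : Finset (ℕ × ℕ)} (h : IsTno n T) :
    ∃ e ∈ Finset.Icc (n + 1) (2 * n + 1),
      IsRowConfig n (Finset.Icc 1 (2 * n + 1) \ {e}) T := by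
  obtain ⟨h1, h2, h3, h4⟩ := h
  have hcard : T.card = 2 * n := by
    rw [Finset.card_eq_sum_card_fiberwise (f := Prod.fst) (t := Finset.Icc 1 n),
      Finset.sum_congr rfl h4]
    · simp [mul_comm]
    · intro p hp
      have := h1 p hp
      simp only [Finset.coe_Icc, Set.mem_Icc]
      omega
  have hinj : Set.InjOn Prod.snd (T : Set (ℕ × ℕ)) := fun p hp q hq hpq =>
    Finset.card_le_one.1 (h2 q.2) p (Finset.mem_filter.2 ⟨hp, hpq⟩) q
      (Finset.mem_filter.2 ⟨hq, rfl⟩)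
  have hsub : T.image Prod.snd ⊆ Finset.Icc 1 (2 * n + 1) := by
    intro i hi
    obtain ⟨p, hp, rfl⟩ := Finset.mem_image.1 hi
    have := h1 p hp
    rw [Finset.mem_Icc]
    omega
  have hone : (Finset.Icc 1 (2 * n + 1) \ T.image Prod.snd).card = 1 := by
    rw [Finset.card_sdiff_of_subset hsub, Finset.card_image_of_injOn hinj, hcard, Nat.card_Icc]
    omega
  obtain ⟨e, he⟩ := Finset.card_eq_one.1 hone
  have hrows : Finset.Icc 1 (2 * n + 1) \ {e} = T.image Prod.snd := by
    rw [← he, Finset.sdiff_sdiff_eq_self hsub]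
  have hemem : e ∈ Finset.Icc 1 (2 * n + 1) \ T.image Prod.snd := by simp [he]
  rw [Finset.mem_sdiff, Finset.mem_Icc] at hemem
  refine ⟨e, ?_, ?_⟩
  · rw [Finset.mem_Icc]
    refine ⟨?_, hemem.1.2⟩
    by_contra hlt
    have h5 := h3 e (Finset.mem_Icc.2 (by omega))
    obtain ⟨p, hp⟩ := Finset.card_pos.1 (h5 ▸ Nat.one_pos)
    rw [Finset.mem_filter] at hp
    exact hemem.2 (Finset.mem_image.2 ⟨p, hp⟩)
  · rw [hrows]
    refine ⟨fun p hp => ?_, fun i hi => ?_, h4⟩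
    · obtain ⟨h5, h6, -, -, h7⟩ := h1 p hp
      exact ⟨h5, h6, Finset.mem_image_of_mem _ hp, h7⟩
    · obtain ⟨p, hp, hpi⟩ := Finset.mem_image.1 hi
      exact le_antisymm (h2 i) (Finset.card_pos.2 ⟨p, Finset.mem_filter.2 ⟨hp, hpi⟩⟩)

lemma IsRowConfig.isTno {n e : ℕ} {T : Finset (ℕ × ℕ)} (he : n + 1 ≤ e)
    (h : IsRowConfig n (Finset.Icc 1 (2 * n + 1) \ {e}) T) : IsTno n T := by
  refine ⟨fun p hp => ?_, fun i => ?_, fun i hi => h.2.1 i ?_, h.2.2⟩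
  · have := h.1 p hp
    simp only [Finset.mem_sdiff, Finset.mem_Icc] at this
    omega
  · rw [Finset.card_le_one]
    rintro ⟨a, b⟩ hp ⟨c, d⟩ hq
    simp only [Finset.mem_filter] at hp hq
    obtain ⟨hp, rfl⟩ := hp
    obtain ⟨hq, rfl⟩ := hq
    rw [h.eq_of_mem hp hq]
  · simp only [Finset.mem_sdiff, Finset.mem_Icc, Finset.mem_singleton] at hi ⊢
    omega

lemma IsRowConfig.row_empty_iff {m i : ℕ} {R : Finset ℕ} {T : Finset (ℕ × ℕ)}
    (h : IsRowConfig m R T) : (∀ p ∈ T, p.2 ≠ i) ↔ i ∉ R := by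
  constructor
  · intro hT hi
    obtain ⟨p, hp⟩ := Finset.card_pos.1 (h.2.1 i hi ▸ Nat.one_pos)
    rw [Finset.mem_filter] at hp
    exact hT p hp.1 hp.2
  · rintro hi p hp rfl
    exact hi (h.1 p hp).2.2.1

lemma IsRowConfig.empty_row_iff {n e i : ℕ} {T : Finset (ℕ × ℕ)}
    (he : e ∈ Finset.Icc (n + 1) (2 * n + 1))
    (h : IsRowConfig n (Finset.Icc 1 (2 * n + 1) \ {e}) T) :
    (1 ≤ i ∧ i ≤ 2 * n + 1 ∧ ∀ p ∈ T, p.2 ≠ i) ↔ i = e := by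
  rw [h.row_empty_iff]
  simp only [Finset.mem_sdiff, Finset.mem_Icc, Finset.mem_singleton] at he ⊢
  omega

lemma IsRowConfig.emptyRowIdx_eq {n e : ℕ} {T : Finset (ℕ × ℕ)}
    (he : e ∈ Finset.Icc (n + 1) (2 * n + 1))
    (h : IsRowConfig n (Finset.Icc 1 (2 * n + 1) \ {e}) T) : emptyRowIdx n T = e := by
  simp only [emptyRowIdx, h.empty_row_iff he, Set.ofPred_eq_eq_singleton, csInf_singleton]

/-- The order-preserving relabelling of rows that closes the gap at row `e`. -/
def deleteRow (e i : ℕ) : ℕ := if e < i then i - 1 else i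

/-- The order-preserving relabelling of rows that opens a gap at row `e`. -/
def insertRow (e i : ℕ) : ℕ := if e ≤ i then i + 1 else i

lemma deleteRow_insertRow (e i : ℕ) : deleteRow e (insertRow e i) = i := by
  unfold deleteRow insertRow
  split_ifs <;> omega

lemma insertRow_deleteRow {e i : ℕ} (h : i ≠ e) : insertRow e (deleteRow e i) = i := by
  unfold deleteRow insertRow
  split_ifs <;> omega

lemma image_insertRow {n e : ℕ} (he : e ∈ Finset.Icc (n + 1) (2 * n + 1)) :
    (Finset.Icc 1 (2 * n)).image (insertRow e) = Finset.Icc 1 (2 * n + 1) \ {e} := by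
  rw [Finset.mem_Icc] at he
  ext i
  simp only [Finset.mem_image, Finset.mem_sdiff, Finset.mem_Icc, Finset.mem_singleton]
  constructor
  · rintro ⟨k, hk, rfl⟩
    unfold insertRow
    split_ifs <;> omega
  · rintro ⟨hi, hne⟩
    refine ⟨deleteRow e i, ?_, insertRow_deleteRow hne⟩
    unfold deleteRow
    split_ifs <;> omega

lemma image_deleteRow {n e : ℕ} (he : e ∈ Finset.Icc (n + 1) (2 * n + 1)) :
    (Finset.Icc 1 (2 * n + 1) \ {e}).image (deleteRow e) = Finset.Icc 1 (2 * n) := by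
  rw [← image_insertRow he, Finset.image_image,
    Finset.image_congr (g := id), Finset.image_id]
  exact fun i _ => deleteRow_insertRow e i

lemma phi_eq_image (n : ℕ) (T : Finset (ℕ × ℕ)) :
    phi n T = T.image (Prod.map id (deleteRow (emptyRowIdx n T))) := by
  unfold phi
  congr 1
  funext p
  unfold deleteRow
  split_ifs with h <;> simp [Prod.map, h]

lemma IsRowConfig.image_deleteRow_mem {n e : ℕ} {T : Finset (ℕ × ℕ)}
    (he : e ∈ Finset.Icc (n + 1) (2 * n + 1))
    (h : IsRowConfig n (Finset.Icc 1 (2 * n + 1) \ {e}) T) :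
    T.image (Prod.map id (deleteRow e)) ∈ TneF n := by
  rw [TneF_eq_rowConfigs, mem_rowConfigs, ← image_deleteRow he]
  rw [Finset.mem_Icc] at he
  refine h.image ?_ fun i _ j _ _ => ?_
  · intro i hi k hk hik
    simp only [Finset.coe_sdiff, Set.mem_sdiff, Finset.coe_singleton, Set.mem_singleton_iff]
      at hi hk
    rw [← insertRow_deleteRow hi.2, hik, insertRow_deleteRow hk.2]
  · unfold deleteRow
    split_ifs <;> omega

lemma isRowConfig_image_insertRow {n e : ℕ} {U : Finset (ℕ × ℕ)} (hU : U ∈ TneF n)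
    (he : e ∈ Finset.Icc (n + 1) (2 * n + 1)) :
    IsRowConfig n (Finset.Icc 1 (2 * n + 1) \ {e}) (U.image (Prod.map id (insertRow e))) := by
  rw [TneF_eq_rowConfigs, mem_rowConfigs] at hU
  rw [← image_insertRow he]
  refine hU.image (Function.LeftInverse.injective (deleteRow_insertRow e)).injOn
    fun i _ j _ _ => ?_
  unfold insertRow
  split_ifs <;> omega

lemma image_deleteRow_image_insertRow (e : ℕ) (U : Finset (ℕ × ℕ)) :
    (U.image (Prod.map id (insertRow e))).image (Prod.map id (deleteRow e)) = U := by
  rw [Finset.image_image, Finset.image_congr (g := id), Finset.image_id]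
  intro p _
  simp [Prod.map, deleteRow_insertRow]

lemma image_insertRow_image_deleteRow {e : ℕ} {T : Finset (ℕ × ℕ)} (hT : ∀ p ∈ T, p.2 ≠ e) :
    (T.image (Prod.map id (deleteRow e))).image (Prod.map id (insertRow e)) = T := by
  rw [Finset.image_image, Finset.image_congr (g := id), Finset.image_id]
  intro p hp
  simp [Prod.map, insertRow_deleteRow (hT p hp)]

lemma phi_image_insertRow {n e : ℕ} {U : Finset (ℕ × ℕ)} (hU : U ∈ TneF n)
    (he : e ∈ Finset.Icc (n + 1) (2 * n + 1)) :
    phi n (U.image (Prod.map id (insertRow e))) = U := by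
  rw [phi_eq_image, (isRowConfig_image_insertRow hU he).emptyRowIdx_eq he,
    image_deleteRow_image_insertRow]

lemma image_insertRow_mem_TnoF {n e : ℕ} {U : Finset (ℕ × ℕ)} (hU : U ∈ TneF n)
    (he : e ∈ Finset.Icc (n + 1) (2 * n + 1)) :
    U.image (Prod.map id (insertRow e)) ∈ TnoF n :=
  mem_TnoF.2 ((isRowConfig_image_insertRow hU he).isTno (Finset.mem_Icc.1 he).1)

lemma phi_mem_TneF {n : ℕ} {T : Finset (ℕ × ℕ)} (hT : T ∈ TnoF n) : phi n T ∈ TneF n := by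
  obtain ⟨e, he, h⟩ := (mem_TnoF.1 hT).exists_isRowConfig
  rw [phi_eq_image, h.emptyRowIdx_eq he]
  exact h.image_deleteRow_mem he

lemma emptyRowIdx_mem {n : ℕ} {T : Finset (ℕ × ℕ)} (hT : T ∈ TnoF n) :
    emptyRowIdx n T ∈ Finset.Icc (n + 1) (2 * n + 1) ∧ ∀ p ∈ T, p.2 ≠ emptyRowIdx n T := by
  obtain ⟨e, he, h⟩ := (mem_TnoF.1 hT).exists_isRowConfig
  rw [h.emptyRowIdx_eq he]
  exact ⟨he, ((h.empty_row_iff he).2 rfl).2.2⟩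

lemma card_fiber_phi {n : ℕ} {U : Finset (ℕ × ℕ)} (hU : U ∈ TneF n) :
    ((TnoF n).filter (fun T => phi n T = U)).card = n + 1 := by
  have hcard : (Finset.Icc (n + 1) (2 * n + 1)).card = n + 1 := by
    rw [Nat.card_Icc]
    omega
  rw [← hcard]
  refine Finset.card_nbij' (emptyRowIdx n) (fun e => U.image (Prod.map id (insertRow e)))
    ?_ ?_ ?_ ?_
  · intro T hT
    exact (emptyRowIdx_mem (Finset.mem_filter.1 hT).1).1
  · intro e he
    exact Finset.mem_filter.2 ⟨image_insertRow_mem_TnoF hU he, phi_image_insertRow hU he⟩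
  · intro T hT
    obtain ⟨hTn, rfl⟩ := Finset.mem_filter.1 hT
    simp only [phi_eq_image]
    exact image_insertRow_image_deleteRow (emptyRowIdx_mem hTn).2
  · intro e he
    exact (isRowConfig_image_insertRow hU he).emptyRowIdx_eq he

lemma two_pow_mul_card_TneF (n : ℕ) :
    2 ^ n * (TneF n).card = n.factorial * (n + 1).factorial := by
  rw [TneF_eq_rowConfigs]
  refine two_pow_mul_card_rowConfigs n _ (by simp)
    (Finset.Icc_subset_Icc_right (by omega)) fun i hi => (Finset.mem_Icc.1 hi).1

/-- Every `T ∈ T_n^o` has exactly one empty row, lying among the rows `n+1,…,2n+1`;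
deleting it gives the surjection `φ : T_n^o → T_n^e`, all of whose fibers have
exactly `n+1` elements; consequently `2^n |T_n^o| = ((n+1)!)^2`. -/
theorem statement7 (n : ℕ) (hn : 1 ≤ n) :
    (∀ T ∈ TnoF n, ∃! i : ℕ, 1 ≤ i ∧ i ≤ 2*n + 1 ∧ ∀ p ∈ T, p.2 ≠ i) ∧
    (∀ T ∈ TnoF n, n + 1 ≤ emptyRowIdx n T ∧ emptyRowIdx n T ≤ 2*n + 1 ∧
      ∀ p ∈ T, p.2 ≠ emptyRowIdx n T) ∧
    (∀ T ∈ TnoF n, phi n T ∈ TneF n) ∧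
    (∀ U ∈ TneF n, ∃ T ∈ TnoF n, phi n T = U) ∧
    (∀ U ∈ TneF n, ((TnoF n).filter (fun T => phi n T = U)).card = n + 1) ∧
    2 ^ n * (TnoF n).card = (Nat.factorial (n+1)) ^ 2 := by
  refine ⟨fun T hT => ?_, fun T hT => ?_, fun T hT => phi_mem_TneF hT, fun U hU => ?_,
    fun U hU => card_fiber_phi hU, ?_⟩
  · obtain ⟨e, he, h⟩ := (mem_TnoF.1 hT).exists_isRowConfig
    exact ⟨e, (h.empty_row_iff he).2 rfl, fun i hi => (h.empty_row_iff he).1 hi⟩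
  · obtain ⟨he, hT⟩ := emptyRowIdx_mem hT
    rw [Finset.mem_Icc] at he
    exact ⟨he.1, he.2, hT⟩
  · have he : n + 1 ∈ Finset.Icc (n + 1) (2 * n + 1) := Finset.mem_Icc.2 (by omega)
    exact ⟨_, image_insertRow_mem_TnoF hU he, phi_image_insertRow hU he⟩
  · rw [Finset.card_eq_sum_card_fiberwise (f := phi n) (t := TneF n) fun T hT => phi_mem_TneF hT,
      Finset.sum_congr rfl fun U hU => card_fiber_phi hU, Finset.sum_const, smul_eq_mul,
      ← mul_assoc, two_pow_mul_card_TneF, sq, Nat.factorial_succ]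
    ring

end SymDellac
end

section
/- For every integer n ≥ 1, D_n(x) = 2^n·(x+1)·P_n(x+1) as polynomials; moreover P_n(x) is a polynomial of degree n−1 all of whose coefficients are positive integers. -/
open scoped Classical

namespace SymDellac

open Polynomial in
/-- Shifting the variable of a polynomial over `ℕ` by two changes it by an even polynomial. -/
theorem exists_comp_X_add_two_eq (p : ℕ[X]) : ∃ h : ℕ[X], p.comp (X + 2) = p + 2 * h := by
  induction p using Polynomial.induction_on with
  | C a => exact ⟨0, by simp⟩
  | add p q hp hq =>
    obtain ⟨f, hf⟩ := hp
    obtain ⟨g, hg⟩ := hq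
    exact ⟨f + g, by rw [add_comp, hf, hg]; ring⟩
  | monomial n a ih =>
    obtain ⟨h, hh⟩ := ih
    refine ⟨h * X + C a * X ^ n + 2 * h, ?_⟩
    rw [pow_succ, ← mul_assoc, mul_comp, hh, X_comp]
    ring

open Polynomial in
/-- The half-difference of `p(x + 2)` and `p(x)` has no coefficients in degree `≥ deg p`. -/
theorem coeff_eq_zero_of_comp_X_add_two_eq {p h : ℕ[X]} (hh : p.comp (X + 2) = p + 2 * h)
    {m : ℕ} (hm : p.natDegree ≤ m) : h.coeff m = 0 := by
  have hX : (X + 2 : ℕ[X]) = X + C 2 := rfl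
  have hdeg : (p.comp (X + 2)).natDegree = p.natDegree := by
    rw [natDegree_comp, hX, natDegree_X_add_C, mul_one]
  have hcoeff : (p.comp (X + 2)).coeff m = p.coeff m := by
    rcases hm.eq_or_lt with rfl | hlt
    · have hlead := leadingCoeff_comp (p := p) (q := X + 2) (by rw [hX, natDegree_X_add_C]; simp)
      rw [hX, leadingCoeff_X_add_C, one_pow, mul_one, ← hX] at hlead
      rwa [leadingCoeff, hdeg] at hlead
    · rw [coeff_eq_zero_of_natDegree_lt (hdeg ▸ hlt), coeff_eq_zero_of_natDegree_lt hlt]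
  rw [hh, coeff_add, show (2 : ℕ[X]) = C 2 from rfl, coeff_C_mul] at hcoeff
  omega

open Polynomial in
/-- `P (n + 1)` comes from a polynomial over `ℕ` of degree `n` with positive coefficients. -/
theorem exists_nat_polynomial_eq_P (n : ℕ) :
    ∃ p : ℕ[X], p.map (Nat.castRingHom ℚ) = P (n + 1) ∧ p.natDegree = n ∧
      ∀ k ≤ n, 0 < p.coeff k := by
  induction n with
  | zero => exact ⟨1, by simp [P], by simp, by simp⟩
  | succ n ih =>
    obtain ⟨p, hP, hdeg, hpos⟩ := ih
    obtain ⟨h, hh⟩ := exists_comp_X_add_two_eq p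
    have hle : ((X ^ 2 + 3 * X + 2) * h + (2 * X + 1) * p).natDegree ≤ n + 1 := by
      refine natDegree_add_le_of_degree_le ?_ ?_
      · rcases eq_or_ne h 0 with rfl | h0
        · simp
        · have hlt : h.natDegree < n := by
            by_contra! hge
            exact leadingCoeff_ne_zero.mpr h0
              (coeff_eq_zero_of_comp_X_add_two_eq hh (hdeg.trans_le hge))
          have h2 : (X ^ 2 + 3 * X + 2 : ℕ[X]).natDegree ≤ 2 := by compute_degree
          exact natDegree_mul_le.trans (by omega)
      · have h1 : (2 * X + 1 : ℕ[X]).natDegree ≤ 1 := by compute_degree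
        exact natDegree_mul_le.trans (by omega)
    have hcoeff : ∀ k ≤ n + 1, 0 < ((X ^ 2 + 3 * X + 2) * h + (2 * X + 1) * p).coeff k := by
      intro k hk
      have hexp : (2 * X + 1) * p = C 2 * (p * X) + p := by
        rw [show (C 2 : ℕ[X]) = 2 from rfl]; ring
      rw [coeff_add, hexp, coeff_add, coeff_C_mul]
      rcases hk.eq_or_lt with rfl | hlt
      · have := hpos n le_rfl
        rw [coeff_mul_X]
        omega
      · have := hpos k (by omega)
        omega
    refine ⟨_, ?_, natDegree_eq_of_le_of_coeff_ne_zero hle (hcoeff _ le_rfl).ne', hcoeff⟩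
    have hmap := congrArg (Polynomial.map (Nat.castRingHom ℚ)) hh
    simp only [Polynomial.map_comp, Polynomial.map_add, Polynomial.map_mul, map_X,
      Polynomial.map_ofNat, hP] at hmap
    have hhalf : (C (1 / 2 : ℚ)) * 2 = 1 := by
      rw [show (2 : ℚ[X]) = C 2 from rfl, ← C_mul]
      norm_num
    rw [P, hmap]
    simp only [Polynomial.map_add, Polynomial.map_mul, Polynomial.map_pow, map_X,
      Polynomial.map_ofNat, Polynomial.map_one, hP]
    linear_combination (-((X ^ 2 + 3 * X + 2) * h.map (Nat.castRingHom ℚ)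
      + (2 * X + 1) * P (n + 1))) * hhalf

open Polynomial in
theorem D_succ_eq (n : ℕ) :
    D (n + 1) = C ((2 : ℚ) ^ (n + 1)) * (X + 1) * (P (n + 1)).comp (X + 1) := by
  induction n with
  | zero =>
    simp only [D, P, one_comp, zero_add, pow_one, show (C 2 : ℚ[X]) = 2 from rfl]
    ring
  | succ n ih =>
    have hhalf : (C (1 / 2 : ℚ)) * 2 = 1 := by
      rw [show (2 : ℚ[X]) = C 2 from rfl, ← C_mul]
      norm_num
    have hcomm : (X + 1 : ℚ[X]).comp (X + 2) = (X + 2 : ℚ[X]).comp (X + 1) := by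
      simp only [add_comp, X_comp, one_comp, ofNat_comp]
      ring
    rw [D, ih, P]
    simp only [mul_comp, sub_comp, comp_assoc, hcomm, C_comp]
    simp only [add_comp, X_comp, one_comp, ofNat_comp, pow_succ _ (n + 1), C_mul,
      show (C 2 : ℚ[X]) = 2 from rfl]
    generalize (P (n + 1)).comp (X + 1 + 2) = A
    generalize (P (n + 1)).comp (X + 1) = B
    linear_combination (-(C (2 ^ (n + 1)) * (X + 1) *
      ((X + 1 + 2) * (X + 1 + 1) * A - (X + 1) * X * B))) * hhalf

/-- For all `n ≥ 1`, `D_n(x) = 2^n (x+1) P_n(x+1)`, and `P_n` is a polynomial of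
degree `n-1` all of whose coefficients are positive integers. -/
theorem statement8 (n : ℕ) (hn : 1 ≤ n) :
    D n = Polynomial.C ((2 : ℚ) ^ n) * (Polynomial.X + 1) *
        ((P n).comp (Polynomial.X + 1)) ∧
    (P n).natDegree = n - 1 ∧
    (∀ k ≤ n - 1, ∃ m : ℕ, 0 < m ∧ (P n).coeff k = m) := by
  obtain ⟨n, rfl⟩ := Nat.exists_eq_add_of_le' hn
  obtain ⟨p, hP, hdeg, hpos⟩ := exists_nat_polynomial_eq_P n
  refine ⟨D_succ_eq n, ?_, fun k hk => ⟨p.coeff k, hpos k hk, ?_⟩⟩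
  · rw [← hP, Polynomial.natDegree_map_eq_of_injective Nat.cast_injective, hdeg,
      Nat.add_sub_cancel]
  · rw [← hP, Polynomial.coeff_map, eq_natCast]

end SymDellac
end

section
/- Write P_n(x) = Σ_{k=0}^{n−1} c_{n,k}·x^k. Then c_{1,0} = 1, and for every n ≥ 2: (i) c_{n,0} = Σ_{i=0}^{n−2} 2^i·c_{n−1,i}; (ii) for every k with 1 ≤ k ≤ n−2, c_{n,k} = (k+1)·c_{n−1,k−1} + Σ_{i=k}^{n−2} 2^{i−k}·( binom(i+1,k) + 2·binom(i+1,k−1) )·c_{n−1,i}; (iii) c_{n,n−1} = n·c_{n−1,n−2}. -/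
open scoped Classical

namespace SymDellac

/-- The linear operator on polynomials that sends `P n` to `P (n + 1)`. -/
noncomputable def polyStep : Polynomial ℚ →ₗ[ℚ] Polynomial ℚ :=
  (1 / 2 : ℚ) •
    (LinearMap.mulLeft ℚ ((Polynomial.X + 2) * (Polynomial.X + 1)) ∘ₗ Polynomial.taylor 2
      - LinearMap.mulLeft ℚ (Polynomial.X * (Polynomial.X - 1)))

lemma P_add_two (n : ℕ) : P (n + 2) = polyStep (P (n + 1)) := by
  have h : (2 : Polynomial ℚ) = Polynomial.C 2 := rfl
  simp only [P, polyStep, Polynomial.taylor_apply, LinearMap.smul_apply, LinearMap.sub_apply,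
    LinearMap.comp_apply, LinearMap.mulLeft_apply, Polynomial.smul_eq_C_mul, h]

lemma polyStep_X_pow (i : ℕ) : polyStep (Polynomial.X ^ i) = (1 / 2 : ℚ) •
    (Polynomial.X * (Polynomial.X + Polynomial.C 2) ^ (i + 1)
      + (Polynomial.X + Polynomial.C 2) ^ (i + 1)
      - (Polynomial.X ^ (i + 2) - Polynomial.X ^ (i + 1))) := by
  have h : (2 : Polynomial ℚ) = Polynomial.C 2 := rfl
  simp only [polyStep, Polynomial.taylor_apply, LinearMap.smul_apply, LinearMap.sub_apply,
    LinearMap.comp_apply, LinearMap.mulLeft_apply, Polynomial.X_pow_comp, h]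
  ring_nf

lemma coeff_zero_polyStep_X_pow (i : ℕ) :
    (polyStep (Polynomial.X ^ i)).coeff 0 = 2 ^ i := by
  simp [polyStep_X_pow, Polynomial.coeff_zero_eq_eval_zero, pow_succ']

lemma coeff_succ_polyStep_X_pow (i k : ℕ) :
    (polyStep (Polynomial.X ^ i)).coeff (k + 1) = (1 / 2 : ℚ) *
      (2 ^ (i + 1 - k) * ((i + 1).choose k : ℚ) + 2 ^ (i - k) * ((i + 1).choose (k + 1) : ℚ)
        - ((if k = i + 1 then 1 else 0) - (if k = i then 1 else 0))) := by
  simp only [polyStep_X_pow, Polynomial.coeff_smul, Polynomial.coeff_sub, Polynomial.coeff_add,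
    Polynomial.coeff_X_mul, Polynomial.coeff_X_add_C_pow, Polynomial.coeff_X_pow, smul_eq_mul,
    Nat.add_sub_add_right, Nat.add_right_cancel_iff]

lemma coeff_polyStep_X_pow_of_le {i k : ℕ} (hk : 1 ≤ k) (hki : k ≤ i) :
    (polyStep (Polynomial.X ^ i)).coeff k =
      2 ^ (i - k) * (((i + 1).choose k : ℚ) + 2 * ((i + 1).choose (k - 1) : ℚ)) := by
  obtain ⟨k, rfl⟩ := Nat.exists_eq_succ_of_ne_zero (Nat.one_le_iff_ne_zero.mp hk)
  obtain ⟨d, rfl⟩ := Nat.exists_eq_add_of_le hki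
  rw [Nat.succ_eq_add_one, coeff_succ_polyStep_X_pow, if_neg (by lia), if_neg (by lia),
    show k + 1 + d + 1 - k = d + 2 by lia, show k + 1 + d - k = d + 1 by lia,
    show k + 1 + d - (k + 1) = d by lia, Nat.add_sub_cancel]
  ring

lemma coeff_succ_polyStep_X_pow_self (i : ℕ) :
    (polyStep (Polynomial.X ^ i)).coeff (i + 1) = i + 2 := by
  rw [coeff_succ_polyStep_X_pow, if_neg (by lia), if_pos rfl, Nat.choose_succ_self_right]
  simp
  ring

lemma coeff_polyStep_X_pow_of_lt {i k : ℕ} (h : i + 1 < k) :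
    (polyStep (Polynomial.X ^ i)).coeff k = 0 := by
  obtain ⟨k, rfl⟩ := Nat.exists_eq_succ_of_ne_zero (Nat.ne_zero_of_lt h)
  rw [Nat.succ_eq_add_one, coeff_succ_polyStep_X_pow, if_neg (show k ≠ i by lia),
    Nat.choose_eq_zero_of_lt (show i + 1 < k + 1 by lia)]
  obtain rfl | hk := eq_or_ne k (i + 1)
  · simp
  · rw [if_neg hk, Nat.choose_eq_zero_of_lt (by lia)]
    simp

lemma coeff_polyStep {p : Polynomial ℚ} {N : ℕ} (hp : p.natDegree < N) (k : ℕ) :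
    (polyStep p).coeff k =
      ∑ i ∈ Finset.range N, (polyStep (Polynomial.X ^ i)).coeff k * p.coeff i := by
  conv_lhs => rw [p.as_sum_range' N hp]
  simp_rw [map_sum, Polynomial.finsetSum_coeff, ← Polynomial.C_mul_X_pow_eq_monomial,
    ← Polynomial.smul_eq_C_mul, map_smul, Polynomial.coeff_smul, smul_eq_mul, mul_comm]

lemma natDegree_P_succ_le (n : ℕ) : (P (n + 1)).natDegree ≤ n := by
  induction n with
  | zero => simp [P]
  | succ n ih =>
    rw [Polynomial.natDegree_le_iff_coeff_eq_zero]
    intro k hk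
    rw [P_add_two, coeff_polyStep (Nat.lt_succ_of_le ih)]
    refine Finset.sum_eq_zero fun i hi => ?_
    rw [coeff_polyStep_X_pow_of_lt (by grind), zero_mul]

lemma coeff_P_add_two (n k : ℕ) : (P (n + 2)).coeff k =
    ∑ i ∈ Finset.range (n + 1),
      (polyStep (Polynomial.X ^ i)).coeff k * (P (n + 1)).coeff i := by
  rw [P_add_two, coeff_polyStep (Nat.lt_succ_of_le (natDegree_P_succ_le n))]

/-- The induction formulas (1), (2), (3) for the coefficients `c_{n,k}` of `P_n`. -/
theorem statement9 :
    (P 1).coeff 0 = 1 ∧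
    ∀ n : ℕ, 2 ≤ n →
      ((P n).coeff 0 = ∑ i ∈ Finset.range (n-1), (2 : ℚ) ^ i * (P (n-1)).coeff i) ∧
      (∀ k : ℕ, 1 ≤ k → k ≤ n - 2 →
        (P n).coeff k = (k + 1 : ℚ) * (P (n-1)).coeff (k-1) +
          ∑ i ∈ Finset.Icc k (n-2), (2 : ℚ) ^ (i - k) *
            (((i+1).choose k : ℚ) + 2 * ((i+1).choose (k-1) : ℚ)) * (P (n-1)).coeff i) ∧
      ((P n).coeff (n-1) = (n : ℚ) * (P (n-1)).coeff (n-2)) := by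
  refine ⟨by simp [P], fun n hn => ?_⟩
  obtain ⟨m, rfl⟩ := Nat.exists_eq_add_of_le' hn
  rw [show m + 2 - 1 = m + 1 by lia, show m + 2 - 2 = m by lia]
  refine ⟨?_, fun k hk hkm => ?_, ?_⟩
  · simp_rw [coeff_P_add_two, coeff_zero_polyStep_X_pow]
  · obtain ⟨j, rfl⟩ := Nat.exists_eq_add_of_le' hk
    rw [coeff_P_add_two, ← Finset.sum_range_add_sum_Ico _ (show j + 1 ≤ m + 1 by lia),
      Finset.sum_range_succ, Finset.sum_eq_zero, zero_add, Nat.add_sub_cancel,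
      coeff_succ_polyStep_X_pow_self, ← Finset.Ico_add_one_right_eq_Icc]
    · congr 1
      · push_cast
        ring
      · refine Finset.sum_congr rfl fun i hi => ?_
        rw [coeff_polyStep_X_pow_of_le hk (Finset.mem_Ico.mp hi).1, Nat.add_sub_cancel]
    · intro i hi
      rw [coeff_polyStep_X_pow_of_lt (by grind), zero_mul]
  · rw [coeff_P_add_two, Finset.sum_range_succ, Finset.sum_eq_zero, zero_add,
      coeff_succ_polyStep_X_pow_self]
    · push_cast
      ring
    · intro i hi
      rw [coeff_polyStep_X_pow_of_lt (by grind), zero_mul]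

end SymDellac
end

section
/- For every integer n ≥ 1, the leading coefficient of P_n equals n!, i.e., the coefficient c_{n,n−1} of x^{n−1} in P_n(x) is n!. -/
open scoped Classical

namespace SymDellac

open Polynomial in
theorem coeff_taylor_of_natDegree_le {R : Type*} [CommRing R] (r : R) (f : R[X]) (k : ℕ)
    (h : f.natDegree ≤ k + 1) :
    (taylor r f).coeff k = f.coeff k + (k + 1) * r * f.coeff (k + 1) := by
  have hd : (hasseDeriv k f).natDegree < 2 := by
    have := natDegree_hasseDeriv_le f k
    omega
  rw [taylor_coeff, eval_eq_sum_range' hd]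
  simp [Finset.sum_range_succ, hasseDeriv_coeff, add_comm 1 k]
  ring

open Polynomial in
/-- The recurrence for `P`, with the shift `x ↦ x + 2` written as a Taylor expansion. -/
theorem P_add_two_s10 (n : ℕ) :
    P (n + 2) = C (1 / 2) * (taylor 2 (P (n + 1)) * X ^ 2 + 3 * (taylor 2 (P (n + 1)) * X) +
      2 * taylor 2 (P (n + 1)) - P (n + 1) * X ^ 2 + P (n + 1) * X) := by
  rw [P, taylor_apply, C_ofNat]
  ring

open Polynomial in
theorem coeff_P_add_two_s10 (n m : ℕ) :
    (P (n + 2)).coeff (m + 2) = 1 / 2 * ((taylor 2 (P (n + 1))).coeff m +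
      3 * (taylor 2 (P (n + 1))).coeff (m + 1) + 2 * (taylor 2 (P (n + 1))).coeff (m + 2) -
      (P (n + 1)).coeff m + (P (n + 1)).coeff (m + 1)) := by
  rw [P_add_two_s10, coeff_C_mul]
  simp only [coeff_add, coeff_sub, coeff_mul_X_pow, coeff_ofNat_mul]
  rw [coeff_mul_X, coeff_mul_X]

open Polynomial in
theorem P_two : P 2 = C 2 * X + C 1 := by
  have h : (C (1 / 2) : ℚ[X]) * 2 = 1 := by
    rw [← C_ofNat, ← C_mul]
    norm_num
  simp only [P, one_comp, C_ofNat, C_1]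
  linear_combination (2 * X + 1) * h

theorem natDegree_P_succ_le_and_coeff (n : ℕ) :
    (P (n + 1)).natDegree ≤ n ∧ (P (n + 1)).coeff n = (Nat.factorial (n + 1) : ℚ) := by
  induction n with
  | zero => simp [P]
  | succ n ih =>
    obtain ⟨hdeg, hcoeff⟩ := ih
    have hP {k : ℕ} (hk : n < k) : (P (n + 1)).coeff k = 0 :=
      Polynomial.coeff_eq_zero_of_natDegree_lt (hdeg.trans_lt hk)
    have hT {k : ℕ} (hk : n ≤ k + 1) :=
      coeff_taylor_of_natDegree_le 2 (P (n + 1)) k (hdeg.trans hk)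
    constructor
    · rw [Polynomial.natDegree_le_iff_coeff_eq_zero]
      intro N hN
      obtain ⟨m, rfl⟩ : ∃ m, N = m + 2 := ⟨N - 2, by omega⟩
      rw [coeff_P_add_two_s10, hT (by omega), hT (by omega), hT (by omega), hP (k := m + 1) (by omega),
        hP (k := m + 1 + 1) (by omega), hP (k := m + 2 + 1) (by omega)]
      ring
    · cases n with
      | zero => simp [P_two, Polynomial.coeff_one]
      | succ m =>
        rw [coeff_P_add_two_s10, hT (by omega), hT (by omega), hT (by omega),
          hP (k := m + 1 + 1) (by omega), hP (k := m + 2 + 1) (by omega), hcoeff, Nat.factorial_succ (m + 1 + 1)]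
        push_cast
        ring

/-- For all `n ≥ 1`, the leading coefficient `c_{n,n-1}` of `P_n` equals `n!`. -/
theorem statement10 (n : ℕ) (hn : 1 ≤ n) :
    (P n).coeff (n-1) = (Nat.factorial n : ℚ) := by
  obtain ⟨m, rfl⟩ : ∃ m, n = m + 1 := ⟨n - 1, by omega⟩
  exact (natDegree_P_succ_le_and_coeff m).2

end SymDellac
end

section
/- In the setting below, the sequence I_T(j,i) = (i_0, i_1, …) is eventually constant, and its eventual value root_T(j,i) belongs to [j, 2n−j] ∪ {2n}. -/
open scoped Classical

namespace SymDellac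

/-- Iterating a map that is injective on a finite set `S`, from a point outside the image of `S`,
eventually leaves `S`. -/
theorem exists_iterate_notMem_of_injOn {α : Type*} {f : α → α} {S : Set α} (hS : S.Finite)
    (hf : Set.InjOn f S) {a : α} (ha : a ∉ f '' S) : ∃ N, f^[N] a ∉ S := by
  by_contra! h
  have key : ∀ k d, f^[k] a ≠ f^[k + d + 1] a := by
    intro k d
    induction k with
    | zero =>
      intro he
      rw [Function.iterate_succ_apply', Function.iterate_zero_apply] at he
      exact ha ⟨_, h _, he.symm⟩
    | succ k ih =>
      intro he
      rw [Function.iterate_succ_apply' f k, Function.iterate_succ_apply' f (k + 1 + d)] at he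
      have hk := hf (h _) (h _) he
      rw [show k + 1 + d = k + d + 1 by omega] at hk
      exact ih hk
  have hinj : Function.Injective fun k => f^[k] a := by
    intro k l hkl
    rcases lt_trichotomy k l with hlt | rfl | hlt
    · obtain ⟨d, rfl⟩ := Nat.exists_eq_add_of_lt hlt
      exact absurd hkl (key k d)
    · rfl
    · obtain ⟨d, rfl⟩ := Nat.exists_eq_add_of_lt hlt
      exact absurd hkl.symm (key l d)
  exact Set.infinite_of_injective_forall_mem hinj h hS

/-- In a column with two points, the lower and upper rows carry points of `T` and are distinct. -/
theorem lowRow_mem_upRow_mem_lt {T : Finset (ℕ × ℕ)} {c : ℕ}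
    (h : (T.filter (fun p => p.1 = c)).card = 2) :
    (c, lowRow T c) ∈ T ∧ (c, upRow T c) ∈ T ∧ lowRow T c < upRow T c := by
  obtain ⟨⟨c₁, r₁⟩, ⟨c₂, r₂⟩, hne, heq⟩ := Finset.card_eq_two.mp h
  have h₁ : (c₁, r₁) ∈ T ∧ c₁ = c := by
    simpa using (Finset.ext_iff.mp heq (c₁, r₁)).mpr (by simp)
  have h₂ : (c₂, r₂) ∈ T ∧ c₂ = c := by
    simpa using (Finset.ext_iff.mp heq (c₂, r₂)).mpr (by simp)
  obtain ⟨h₁, rfl⟩ := h₁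
  obtain ⟨h₂, rfl⟩ := h₂
  have hbdd : BddAbove {i | (c₂, i) ∈ T} :=
    ((T.image Prod.snd).finite_toSet.subset fun i hi =>
      Finset.mem_coe.mpr (Finset.mem_image_of_mem Prod.snd hi)).bddAbove
  refine ⟨Nat.sInf_mem (s := {i | (c₂, i) ∈ T}) ⟨r₁, h₁⟩,
    Nat.sSup_mem (s := {i | (c₂, i) ∈ T}) ⟨r₁, h₁⟩ hbdd, ?_⟩
  have hr : r₁ ≠ r₂ := fun he => hne (by rw [he])
  have hl₁ : lowRow T c₂ ≤ r₁ := Nat.sInf_le h₁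
  have hl₂ : lowRow T c₂ ≤ r₂ := Nat.sInf_le h₂
  have hu₁ : r₁ ≤ upRow T c₂ := le_csSup hbdd h₁
  have hu₂ : r₂ ≤ upRow T c₂ := le_csSup hbdd h₂
  omega

/-- **Proposition 1.6 (first part).** The sequence `I_T(j,i)` is eventually constant,
with eventual value in `[j, 2n-j] ∪ {2n}`. -/
theorem statement11 (n j : ℕ) (hn : 1 ≤ n) (hj1 : 1 ≤ j) (hjn : j ≤ n)
    (T : Finset (ℕ × ℕ))
    (hbox : ∀ p ∈ T, 1 ≤ p.1 ∧ p.1 ≤ n ∧ 1 ≤ p.2 ∧ p.2 ≤ 2*n)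
    (hcol : ∀ c : ℕ, (T.filter (fun p => p.1 = c)).card ≤ 2)
    (hrow : ∀ r : ℕ, (T.filter (fun p => p.2 = r)).card ≤ 1)
    (hlowrow : ∀ r : ℕ, 1 ≤ r → r ≤ j - 1 →
      (T.filter (fun p => p.2 = r)).card = 1 ∧ ∀ p ∈ T, p.2 = r → p.1 ≤ p.2)
    (hlowcol : ∀ c : ℕ, 1 ≤ c → c ≤ j - 1 → (T.filter (fun p => p.1 = c)).card = 2)
    (i : ℕ) (hij : j ≤ i) (hi2n : i ≤ 2*n)
    (hifree : ∀ p ∈ T, p.2 = i → j ≤ p.1) :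
    ∃ v N : ℕ, (∀ k ≥ N, (rStep (2*n) j T)^[k] i = v) ∧
      ((j ≤ v ∧ v ≤ 2*n - j) ∨ v = 2*n) := by
  set f := rStep (2*n) j T with hf
  let S : Set ℕ := {x | (1 ≤ x ∧ x ≤ j - 1) ∨ (2*n - j + 1 ≤ x ∧ x ≤ 2*n - 1)}
  have hlow : ∀ x, 1 ≤ x → x ≤ j - 1 → f x = lowRow T x := fun x h₁ h₂ => by
    rw [hf, rStep, if_neg (by omega), if_neg (by omega)]
  have hup : ∀ x, 2*n - j + 1 ≤ x → x ≤ 2*n - 1 → f x = upRow T (2*n - x) := fun x h₁ h₂ => by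
    rw [hf, rStep, if_neg (by omega), if_pos ⟨h₁, h₂⟩]
  have hrowinj : ∀ c d r, (c, r) ∈ T → (d, r) ∈ T → c = d := fun c d r hc hd =>
    congrArg Prod.fst (Finset.card_le_one.mp (hrow r) (c, r) (by simp [hc]) (d, r) (by simp [hd]))
  have himage : ∀ x ∈ S, ∃ c, c ≤ j - 1 ∧ (c, f x) ∈ T := by
    rintro x (⟨h₁, h₂⟩ | ⟨h₁, h₂⟩)
    · exact ⟨x, h₂, hlow x h₁ h₂ ▸ (lowRow_mem_upRow_mem_lt (hlowcol x h₁ h₂)).1⟩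
    · exact ⟨2*n - x, by omega, hup x h₁ h₂ ▸
        (lowRow_mem_upRow_mem_lt (hlowcol (2*n - x) (by omega) (by omega))).2.1⟩
  have hinj : Set.InjOn f S := by
    rintro x (⟨hx₁, hx₂⟩ | ⟨hx₁, hx₂⟩) y (⟨hy₁, hy₂⟩ | ⟨hy₁, hy₂⟩) hxy
    · rw [hlow x hx₁ hx₂, hlow y hy₁ hy₂] at hxy
      obtain ⟨hx, -⟩ := lowRow_mem_upRow_mem_lt (hlowcol x hx₁ hx₂)
      obtain ⟨hy, -⟩ := lowRow_mem_upRow_mem_lt (hlowcol y hy₁ hy₂)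
      exact hrowinj _ _ _ (hxy ▸ hx) hy
    · rw [hlow x hx₁ hx₂, hup y hy₁ hy₂] at hxy
      obtain ⟨hx, -, hlt⟩ := lowRow_mem_upRow_mem_lt (hlowcol x hx₁ hx₂)
      obtain ⟨-, hy, -⟩ :=
        lowRow_mem_upRow_mem_lt (hlowcol (2*n - y) (by omega) (by omega))
      rw [hxy] at hx
      have hc := hrowinj _ _ _ hx hy
      rw [← hc] at hxy
      omega
    · rw [hup x hx₁ hx₂, hlow y hy₁ hy₂] at hxy
      obtain ⟨hy, -, hlt⟩ := lowRow_mem_upRow_mem_lt (hlowcol y hy₁ hy₂)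
      obtain ⟨-, hx, -⟩ :=
        lowRow_mem_upRow_mem_lt (hlowcol (2*n - x) (by omega) (by omega))
      rw [hxy] at hx
      have hc := hrowinj _ _ _ hx hy
      rw [hc] at hxy
      omega
    · rw [hup x hx₁ hx₂, hup y hy₁ hy₂] at hxy
      obtain ⟨-, hx, -⟩ :=
        lowRow_mem_upRow_mem_lt (hlowcol (2*n - x) (by omega) (by omega))
      obtain ⟨-, hy, -⟩ :=
        lowRow_mem_upRow_mem_lt (hlowcol (2*n - y) (by omega) (by omega))
      rw [hxy] at hx
      have hc := hrowinj _ _ _ hx hy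
      omega
  have hfin : S.Finite := (Set.finite_Iic (2*n)).subset fun x hx => by
    rcases hx with hx | hx <;> simp only [Set.mem_Iic] <;> omega
  have hi : i ∉ f '' S := by
    rintro ⟨x, hx, rfl⟩
    obtain ⟨c, hc, hcT⟩ := himage x hx
    have hcj : j ≤ c := hifree _ hcT rfl
    omega
  have hfix : ∀ x, (j ≤ x ∧ x ≤ 2*n - j) ∨ x = 2*n → f x = x := fun x hx => by
    rw [hf, rStep, if_pos hx]
  have hrange : ∀ k, 1 ≤ f^[k] i ∧ f^[k] i ≤ 2*n := by
    intro k
    induction k with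
    | zero => exact ⟨hj1.trans hij, hi2n⟩
    | succ k ih =>
      rw [Function.iterate_succ_apply']
      by_cases hk : f^[k] i ∈ S
      · obtain ⟨c, -, hc⟩ := himage _ hk
        exact (hbox _ hc).2.2
      · have hk' : ¬((1 ≤ f^[k] i ∧ f^[k] i ≤ j - 1) ∨
          (2*n - j + 1 ≤ f^[k] i ∧ f^[k] i ≤ 2*n - 1)) := hk
        rwa [hfix _ (by omega)]
  obtain ⟨N, hN⟩ := exists_iterate_notMem_of_injOn hfin hinj hi
  have hN' : ¬((1 ≤ f^[N] i ∧ f^[N] i ≤ j - 1) ∨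
    (2*n - j + 1 ≤ f^[N] i ∧ f^[N] i ≤ 2*n - 1)) := hN
  have hroot : (j ≤ f^[N] i ∧ f^[N] i ≤ 2*n - j) ∨ f^[N] i = 2*n := by
    have := hrange N
    omega
  refine ⟨f^[N] i, N, fun k hk => ?_, hroot⟩
  obtain ⟨d, rfl⟩ := Nat.exists_eq_add_of_le' hk
  rw [Function.iterate_add_apply, Function.iterate_fixed (hfix _ hroot)]

end SymDellac
end

section
/- In the setting below, the number of rows i ∈ {j,…,2n} containing no point of T in columns 1,…,j−1 is exactly 2(n−j+1), and the map i ↦ root_T(j,i) is a bijection from the set of such rows onto [j, 2n−j] ∪ {2n}. -/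
open scoped Classical

namespace SymDellac

/-- Two orbits that run through `N` up to the meeting time and start outside the image of `N` meet only
if they coincide, at the same time. -/
theorem iterate_eq_iterate {α : Type*} {f : α → α} {N : Set α} (hinj : Set.InjOn f N)
    {s t : α} (hs : s ∉ f '' N) (ht : t ∉ f '' N) :
    ∀ {a b : ℕ}, (∀ k < a, f^[k] s ∈ N) → (∀ k < b, f^[k] t ∈ N) →
      f^[a] s = f^[b] t → a = b ∧ s = t := by
  intro a
  induction a with
  | zero =>
    intro b _ hb h
    cases b with
    | zero => exact ⟨rfl, h⟩
    | succ b =>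
      rw [Function.iterate_succ_apply'] at h
      exact absurd ⟨_, hb b b.lt_succ_self, h.symm⟩ hs
  | succ a ih =>
    intro b ha hb h
    cases b with
    | zero =>
      rw [Function.iterate_succ_apply'] at h
      exact absurd ⟨_, ha a a.lt_succ_self, h⟩ ht
    | succ b =>
      rw [Function.iterate_succ_apply', Function.iterate_succ_apply'] at h
      obtain ⟨h1, h2⟩ := ih (fun k hk => ha k (by omega)) (fun k hk => hb k (by omega))
        (hinj (ha a a.lt_succ_self) (hb b b.lt_succ_self) h)
      exact ⟨by omega, h2⟩

/-- If `f` is injective on a finite set `N`, every orbit starting outside the image of `N` leaves `N`. -/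
theorem exists_first_exit {α : Type*} {f : α → α} {N : Set α} (hfin : N.Finite)
    (hinj : Set.InjOn f N) {s : α} (hs : s ∉ f '' N) :
    ∃ a, (∀ k < a, f^[k] s ∈ N) ∧ f^[a] s ∉ N := by
  have hex : ∃ a, f^[a] s ∉ N := by
    by_contra! hall
    have hinj' : Function.Injective fun k => f^[k] s := fun a b hab =>
      (iterate_eq_iterate hinj hs hs (fun k _ => hall k) (fun k _ => hall k) hab).1
    exact Set.infinite_of_injective_forall_mem hinj' hall hfin
  exact ⟨Nat.find hex, fun k hk => not_not.1 (Nat.find_min hex hk), Nat.find_spec hex⟩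

theorem rootVal_eq_of_fixed {R j : ℕ} {T : Finset (ℕ × ℕ)} {i a : ℕ}
    (h : rStep R j T ((rStep R j T)^[a] i) = (rStep R j T)^[a] i) :
    rootVal R j T i = (rStep R j T)^[a] i := by
  have hconst : ∀ k ≥ a, (rStep R j T)^[k] i = (rStep R j T)^[a] i := by
    intro k hk
    obtain ⟨m, rfl⟩ := Nat.exists_eq_add_of_le' hk
    rw [Function.iterate_add_apply]
    exact Function.iterate_fixed h m
  have hex : ∃ v, ∃ N, ∀ k ≥ N, (rStep R j T)^[k] i = v := ⟨_, a, hconst⟩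
  rw [rootVal, dif_pos hex]
  obtain ⟨M, hM⟩ := hex.choose_spec
  rw [← hM (max M a) (le_max_left _ _), hconst _ (le_max_right _ _)]

theorem lowRow_lt_upRow_of_card_eq_two {T : Finset (ℕ × ℕ)} {c : ℕ}
    (h : (T.filter (fun p => p.1 = c)).card = 2) :
    lowRow T c < upRow T c ∧ ∀ i, (c, i) ∈ T ↔ i = lowRow T c ∨ i = upRow T c := by
  obtain ⟨⟨p1, p2⟩, ⟨q1, q2⟩, hne, hpq⟩ := Finset.card_eq_two.1 h
  have hmem : ∀ x : ℕ × ℕ, (x ∈ T ∧ x.1 = c) ↔ x = (p1, p2) ∨ x = (q1, q2) := by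
    intro x
    simpa using Finset.ext_iff.1 hpq x
  obtain rfl : p1 = c := ((hmem (p1, p2)).2 (Or.inl rfl)).2
  obtain rfl : q1 = p1 := ((hmem (q1, q2)).2 (Or.inr rfl)).2
  have hset : {i | (q1, i) ∈ T} = {p2, q2} := by
    ext i
    simpa using hmem (q1, i)
  have hlow : lowRow T q1 = p2 ⊓ q2 := by rw [lowRow, hset, csInf_pair]
  have hup : upRow T q1 = p2 ⊔ q2 := by rw [upRow, hset, csSup_pair]
  have hne' : p2 ≠ q2 := fun e => hne (by rw [e])
  refine ⟨by rw [hlow, hup]; exact inf_lt_sup.2 hne', fun i => ?_⟩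
  have hi : (q1, i) ∈ T ↔ i = p2 ∨ i = q2 := Set.ext_iff.1 hset i
  rw [hi, hlow, hup]
  omega

theorem rStep_of_lt {R j x : ℕ} (T : Finset (ℕ × ℕ)) (hR : 2 * j ≤ R) (hx : x < j) :
    rStep R j T x = lowRow T x := by
  rw [rStep, if_neg (by omega), if_neg (by omega)]

theorem rStep_sub {R j c : ℕ} (T : Finset (ℕ × ℕ)) (hR : 2 * j ≤ R) (hc : 1 ≤ c) (hcj : c < j) :
    rStep R j T (R - c) = upRow T c := by
  rw [rStep, if_neg (by omega), if_pos (by omega), Nat.sub_sub_self (by omega)]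

/-- The rows in `{1,…,R}` that are not fixed by `rStep R j T`. -/
def movingRows (R j : ℕ) : Finset ℕ := Finset.Icc 1 (j - 1) ∪ Finset.Icc (R - j + 1) (R - 1)

theorem mem_movingRows {R j x : ℕ} (hR : 2 * j ≤ R) :
    x ∈ movingRows R j ↔ ∃ c, 1 ≤ c ∧ c < j ∧ (x = c ∨ x = R - c) := by
  simp only [movingRows, Finset.mem_union, Finset.mem_Icc]
  constructor
  · rintro (h | h)
    · exact ⟨x, by omega⟩
    · exact ⟨R - x, by omega⟩
  · rintro ⟨c, h⟩
    omega

theorem card_movingRows {R j : ℕ} (hj : 1 ≤ j) (hR : 2 * j ≤ R) :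
    (movingRows R j).card = 2 * (j - 1) := by
  rw [movingRows, Finset.card_union_of_disjoint]
  · simp only [Nat.card_Icc]
    omega
  · rw [Finset.disjoint_left]
    intro x
    simp only [Finset.mem_Icc]
    omega

theorem rStep_injOn_movingRows {R j : ℕ} {T : Finset (ℕ × ℕ)} (hR : 2 * j ≤ R)
    (hrow : ∀ r : ℕ, (T.filter (fun p => p.2 = r)).card ≤ 1)
    (hlowcol : ∀ c : ℕ, 1 ≤ c → c < j → (T.filter (fun p => p.1 = c)).card = 2) :
    Set.InjOn (rStep R j T) (movingRows R j) := by
  have hcolumn : ∀ {c d i : ℕ}, (c, i) ∈ T → (d, i) ∈ T → c = d := by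
    intro c d i hc hd
    exact congrArg Prod.fst (Finset.card_le_one.1 (hrow i) (c, i) (by simpa using hc)
      (d, i) (by simpa using hd))
  intro x hx y hy hxy
  obtain ⟨c, hc1, hcj, hxc⟩ := (mem_movingRows hR).1 (Finset.mem_coe.1 hx)
  obtain ⟨d, hd1, hdj, hyd⟩ := (mem_movingRows hR).1 (Finset.mem_coe.1 hy)
  obtain ⟨hlt, hc⟩ := lowRow_lt_upRow_of_card_eq_two (hlowcol c hc1 hcj)
  obtain ⟨-, hd⟩ := lowRow_lt_upRow_of_card_eq_two (hlowcol d hd1 hdj)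
  have hxT : (c, rStep R j T x) ∈ T := by
    rcases hxc with rfl | rfl
    · rw [rStep_of_lt T hR hcj, hc]; exact Or.inl rfl
    · rw [rStep_sub T hR hc1 hcj, hc]; exact Or.inr rfl
  have hyT : (d, rStep R j T y) ∈ T := by
    rcases hyd with rfl | rfl
    · rw [rStep_of_lt T hR hdj, hd]; exact Or.inl rfl
    · rw [rStep_sub T hR hd1 hdj, hd]; exact Or.inr rfl
  rw [← hxy] at hyT
  obtain rfl := hcolumn hxT hyT
  rcases hxc with rfl | rfl <;> rcases hyd with rfl | rfl
  · rfl
  · rw [rStep_of_lt T hR hcj, rStep_sub T hR hc1 hcj] at hxy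
    omega
  · rw [rStep_of_lt T hR hcj, rStep_sub T hR hc1 hcj] at hxy
    omega
  · rfl

/-- The image of the moving rows consists of the rows with a point in columns `1,…,j-1`. -/
theorem mem_image_rStep_movingRows {R j : ℕ} {T : Finset (ℕ × ℕ)} (hR : 2 * j ≤ R)
    (hlowcol : ∀ c : ℕ, 1 ≤ c → c < j → (T.filter (fun p => p.1 = c)).card = 2) {i : ℕ} :
    i ∈ rStep R j T '' movingRows R j ↔ ∃ c, 1 ≤ c ∧ c < j ∧ (c, i) ∈ T := by
  have hT : ∀ {c : ℕ}, 1 ≤ c → c < j →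
      ((c, i) ∈ T ↔ rStep R j T c = i ∨ rStep R j T (R - c) = i) := by
    intro c hc1 hcj
    rw [(lowRow_lt_upRow_of_card_eq_two (hlowcol c hc1 hcj)).2, rStep_of_lt T hR hcj,
      rStep_sub T hR hc1 hcj, eq_comm (a := i), eq_comm (a := i)]
  constructor
  · rintro ⟨x, hx, rfl⟩
    obtain ⟨c, hc1, hcj, hxc⟩ := (mem_movingRows hR).1 (Finset.mem_coe.1 hx)
    refine ⟨c, hc1, hcj, (hT hc1 hcj).2 ?_⟩
    rcases hxc with rfl | rfl
    · exact Or.inl rfl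
    · exact Or.inr rfl
  · rintro ⟨c, hc1, hcj, hc⟩
    rcases (hT hc1 hcj).1 hc with h | h
    · exact ⟨c, (mem_movingRows hR).2 ⟨c, hc1, hcj, Or.inl rfl⟩, h⟩
    · exact ⟨R - c, (mem_movingRows hR).2 ⟨c, hc1, hcj, Or.inr rfl⟩, h⟩

/-- **Proposition 1.6 (second part).** There are exactly `2(n-j+1)` rows
`i ∈ {j,…,2n}` with no point of `T` in columns `1,…,j-1`, and
`i ↦ root_T(j,i)` is a bijection from this set of rows onto `[j, 2n-j] ∪ {2n}`. -/
theorem statement12 (n j : ℕ) (hn : 1 ≤ n) (hj1 : 1 ≤ j) (hjn : j ≤ n)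
    (T : Finset (ℕ × ℕ))
    (hbox : ∀ p ∈ T, 1 ≤ p.1 ∧ p.1 ≤ n ∧ 1 ≤ p.2 ∧ p.2 ≤ 2*n)
    (hcol : ∀ c : ℕ, (T.filter (fun p => p.1 = c)).card ≤ 2)
    (hrow : ∀ r : ℕ, (T.filter (fun p => p.2 = r)).card ≤ 1)
    (hlowrow : ∀ r : ℕ, 1 ≤ r → r ≤ j - 1 →
      (T.filter (fun p => p.2 = r)).card = 1 ∧ ∀ p ∈ T, p.2 = r → p.1 ≤ p.2)
    (hlowcol : ∀ c : ℕ, 1 ≤ c → c ≤ j - 1 → (T.filter (fun p => p.1 = c)).card = 2) :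
    ((Finset.Icc j (2*n)).filter (fun i => ∀ p ∈ T, p.2 = i → j ≤ p.1)).card
        = 2 * (n - j + 1) ∧
    Set.BijOn (fun i => rootVal (2*n) j T i)
      ↑((Finset.Icc j (2*n)).filter (fun i => ∀ p ∈ T, p.2 = i → j ≤ p.1))
      (Set.Icc j (2*n - j) ∪ {2*n}) := by
  have hR : 2 * j ≤ 2 * n := by omega
  have hlowcol' : ∀ c : ℕ, 1 ≤ c → c < j → (T.filter (fun p => p.1 = c)).card = 2 :=
    fun c hc1 hcj => hlowcol c hc1 (by omega)
  set f := rStep (2 * n) j T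
  set N := movingRows (2 * n) j with hN
  set S := (Finset.Icc j (2*n)).filter (fun i => ∀ p ∈ T, p.2 = i → j ≤ p.1) with hS
  have hinj : Set.InjOn f N := rStep_injOn_movingRows hR hrow hlowcol'
  have himg : ∀ {i}, i ∈ f '' N ↔ ∃ c, 1 ≤ c ∧ c < j ∧ (c, i) ∈ T :=
    mem_image_rStep_movingRows hR hlowcol'
  have hNU : N ⊆ Finset.Icc 1 (2 * n) := by
    intro x hx
    obtain ⟨c, h⟩ := (mem_movingRows hR).1 hx
    rw [Finset.mem_Icc]
    omega
  have himgU : N.image f ⊆ Finset.Icc 1 (2 * n) := by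
    intro i hi
    rw [← Finset.mem_coe, Finset.coe_image] at hi
    obtain ⟨c, -, -, hc⟩ := himg.1 hi
    exact Finset.mem_Icc.2 (hbox _ hc).2.2
  have hSeq : S = Finset.Icc 1 (2 * n) \ N.image f := by
    ext i
    rw [Finset.mem_sdiff, ← Finset.mem_coe (s := N.image f), Finset.coe_image, himg, hS,
      Finset.mem_filter, Finset.mem_Icc, Finset.mem_Icc]
    constructor
    · rintro ⟨hi, h⟩
      refine ⟨by omega, ?_⟩
      rintro ⟨c, -, hcj, hc⟩
      exact absurd (h _ hc rfl) (by simpa using hcj)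
    · rintro ⟨hi, h⟩
      have hfree : ∀ p ∈ T, p.2 = i → j ≤ p.1 := by
        rintro ⟨c, r⟩ hp rfl
        by_contra! hlt
        exact h ⟨c, (hbox _ hp).1, hlt, hp⟩
      refine ⟨⟨?_, hi.2⟩, hfree⟩
      by_contra! hlt
      obtain ⟨hcard, hle⟩ := hlowrow i hi.1 (by omega)
      obtain ⟨p, hp⟩ := Finset.card_pos.1 (hcard ▸ Nat.one_pos)
      obtain ⟨hpT, hpi⟩ := Finset.mem_filter.1 hp
      have h1 := hfree p hpT hpi
      have h2 := hle p hpT hpi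
      omega
  have hcardN : N.card = 2 * (j - 1) := card_movingRows hj1 hR
  have hcardS : S.card = 2 * (n - j + 1) := by
    rw [hSeq, Finset.card_sdiff_of_subset himgU, Finset.card_image_of_injOn hinj, Nat.card_Icc,
      hcardN]
    omega
  have hFeq : (Set.Icc j (2 * n - j) ∪ {2 * n} : Set ℕ) = ↑(Finset.Icc 1 (2 * n) \ N) := by
    ext x
    simp only [hN, movingRows, Set.mem_union, Set.mem_Icc, Set.mem_singleton_iff,
      Finset.coe_sdiff, Set.mem_sdiff, Finset.mem_coe, Finset.mem_union, Finset.mem_Icc]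
    omega
  have hcardF : (Finset.Icc 1 (2 * n) \ N).card = 2 * (n - j + 1) := by
    rw [Finset.card_sdiff_of_subset hNU, Nat.card_Icc, hcardN]
    omega
  have hfix : ∀ x ∈ Finset.Icc 1 (2 * n) \ N, f x = x := by
    intro x hx
    rw [← Finset.mem_coe, ← hFeq] at hx
    exact if_pos hx
  have hroot : ∀ s ∈ S, s ∉ f '' N ∧ ∃ a, (∀ k < a, f^[k] s ∈ (N : Set ℕ)) ∧
      rootVal (2 * n) j T s = f^[a] s ∧ f^[a] s ∈ Finset.Icc 1 (2 * n) \ N := by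
    intro s hs
    rw [hSeq, Finset.mem_sdiff, ← Finset.mem_coe (s := N.image f), Finset.coe_image] at hs
    obtain ⟨a, ha, haN⟩ := exists_first_exit N.finite_toSet hinj hs.2
    have hmem : f^[a] s ∈ Finset.Icc 1 (2 * n) \ N := by
      refine Finset.mem_sdiff.2 ⟨?_, haN⟩
      cases a with
      | zero => exact hs.1
      | succ a =>
        rw [Function.iterate_succ_apply']
        exact himgU (Finset.mem_image_of_mem f (ha a a.lt_succ_self))
    exact ⟨hs.2, a, ha, rootVal_eq_of_fixed (hfix _ hmem), hmem⟩
  have hmaps : Set.MapsTo (fun i => rootVal (2 * n) j T i) S ↑(Finset.Icc 1 (2 * n) \ N) := by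
    intro s hs
    obtain ⟨-, a, -, hval, hmem⟩ := hroot s hs
    rw [Finset.mem_coe, show (fun i => rootVal (2 * n) j T i) s = f^[a] s from hval]
    exact hmem
  have hinjRoot : Set.InjOn (fun i => rootVal (2 * n) j T i) S := by
    intro s hs t ht hst
    obtain ⟨hs', a, ha, hsa, -⟩ := hroot s hs
    obtain ⟨ht', b, hb, htb, -⟩ := hroot t ht
    exact (iterate_eq_iterate hinj hs' ht' ha hb (hsa ▸ htb ▸ hst)).2
  rw [hFeq]
  exact ⟨hcardS, hmaps, hinjRoot, Finset.surjOn_of_injOn_of_card_le _ hmaps hinjRoot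
    (by rw [hcardF, hcardS])⟩

end SymDellac
end

section
/- For every n ≥ 1 and every T ∈ T_n^o, the v(T) elements of V(T) and the g(T) elements of G(T) are pairwise distinct free points of T; consequently fr(T) ≥ v(T) + g(T). -/
open scoped Classical

namespace SymDellac

theorem rowPt_spec {T : Finset (ℕ × ℕ)} {r : ℕ} (h : ∃ p ∈ T, p.2 = r) :
    rowPt T r ∈ T ∧ (rowPt T r).2 = r := by
  rw [rowPt, dif_pos h]
  exact h.choose_spec

theorem stepO_mem {n : ℕ} {T : Finset (ℕ × ℕ)} {p : ℕ × ℕ} (hp : p ∈ T) : stepO n T p ∈ T := by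
  unfold stepO
  dsimp only
  split_ifs with _ _ h h
  exacts [hp, (rowPt_spec h).1, hp, (rowPt_spec h).1, hp]

/-- A step either stays put or moves to one of the two rows attached to the current column. -/
theorem stepO_eq_or_row (n : ℕ) (T : Finset (ℕ × ℕ)) (p : ℕ × ℕ) :
    stepO n T p = p ∨ (stepO n T p).2 = 2 * n + 1 - p.1 ∨ (stepO n T p).2 = p.1 := by
  unfold stepO
  dsimp only
  split_ifs with _ _ h h
  exacts [.inl rfl, .inr (.inl (rowPt_spec h).2), .inl rfl, .inr (.inr (rowPt_spec h).2), .inl rfl]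

theorem pathO_succ (n : ℕ) (T : Finset (ℕ × ℕ)) (i k : ℕ) :
    pathO n T i (k + 1) = stepO n T (pathO n T i k) :=
  Function.iterate_succ_apply' _ _ _

theorem pathO_mem {n : ℕ} {T : Finset (ℕ × ℕ)} {i : ℕ} (h : ∃ p ∈ T, p.2 = i) (k : ℕ) :
    pathO n T i k ∈ T := by
  induction k with
  | zero => exact (rowPt_spec h).1
  | succ k ih => rw [pathO_succ]; exact stepO_mem ih

theorem mem_Vset_iff {n : ℕ} {T : Finset (ℕ × ℕ)} {p : ℕ × ℕ} :
    p ∈ Vset n T ↔ (∃ q ∈ T, q.2 = 2 * n + 1) ∧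
      ∃ k, pathO n T (2 * n + 1) k = p ∧ ∀ k' < k, (pathO n T (2 * n + 1) k').1 < p.1 := by
  unfold Vset
  split_ifs with h <;> simp [h]

/-- The points of `V(T)` are free points of `T`. -/
theorem Vset_subset_free {n : ℕ} {T : Finset (ℕ × ℕ)} (hT : IsTno n T) :
    Vset n T ⊆ {p | p ∈ T ∧ 2 * n + 2 ≤ p.2 + p.1} := by
  intro p hp
  obtain ⟨h, k, rfl, hk⟩ := mem_Vset_iff.1 hp
  refine ⟨pathO_mem h k, ?_⟩
  obtain ⟨h1, -, -, -, h2⟩ := hT.1 _ (pathO_mem (n := n) h k)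
  cases k with
  | zero =>
    have h3 : (pathO n T (2 * n + 1) 0).2 = 2 * n + 1 := (rowPt_spec h).2
    omega
  | succ k =>
    have h3 := hk k (Nat.lt_succ_self k)
    rw [pathO_succ] at h1 h2 h3 ⊢
    rcases stepO_eq_or_row n T (pathO n T (2 * n + 1) k) with h4 | h4 | h4
    · rw [h4] at h3
      exact absurd h3 (lt_irrefl _)
    all_goals omega

/-- `V(T)` has at most one point in each column. -/
theorem Vset_injOn_fst (n : ℕ) (T : Finset (ℕ × ℕ)) : Set.InjOn Prod.fst (Vset n T) := by
  intro p hp q hq hpq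
  obtain ⟨-, k, rfl, hk⟩ := mem_Vset_iff.1 hp
  obtain ⟨-, l, rfl, hl⟩ := mem_Vset_iff.1 hq
  rcases lt_trichotomy k l with hkl | rfl | hkl
  · exact absurd hpq (hl k hkl).ne
  · rfl
  · exact absurd hpq.symm (hk l hkl).ne

theorem disjoint_Vset_GsetO (n : ℕ) (T : Finset (ℕ × ℕ)) :
    Disjoint (Vset n T) (GsetO n T) := by
  rw [Set.disjoint_left]
  rintro p hp ⟨-, -, ⟨q, -, hqp, hne, hq⟩, -⟩
  exact hne (Vset_injOn_fst n T hq hp hqp)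

/-- **Remark 1.14.** For all `T ∈ T_n^o`, the `v(T)` elements of `V(T)` and the
`g(T)` elements of `G(T)` are pairwise distinct free points of `T`; consequently
`fr(T) ≥ v(T) + g(T)`. -/
theorem statement14 (n : ℕ) (hn : 1 ≤ n) (T : Finset (ℕ × ℕ)) (hT : T ∈ TnoF n) :
    (Vset n T ∪ GsetO n T ⊆ {p : ℕ × ℕ | p ∈ T ∧ 2*n + 2 ≤ p.2 + p.1}) ∧
    Vset n T ∩ GsetO n T = ∅ ∧
    vStat n T + gStatO n T ≤ frO n T := by
  have hfree : Vset n T ∪ GsetO n T ⊆ {p : ℕ × ℕ | p ∈ T ∧ 2*n + 2 ≤ p.2 + p.1} :=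
    Set.union_subset (Vset_subset_free (Finset.mem_filter.1 hT).2) fun _ hp => ⟨hp.1, hp.2.1⟩
  have hdisj := disjoint_Vset_GsetO n T
  refine ⟨hfree, hdisj.inter_eq, ?_⟩
  rw [← Finset.coe_filter] at hfree
  have hfin := (Finset.finite_toSet _).subset hfree
  calc vStat n T + gStatO n T = (Vset n T ∪ GsetO n T).ncard :=
        (Set.ncard_union_eq hdisj (hfin.subset Set.subset_union_left)
          (hfin.subset Set.subset_union_right)).symm
    _ ≤ _ := Set.ncard_le_ncard hfree (Finset.finite_toSet _)
    _ = frO n T := Set.ncard_coe_finset _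

end SymDellac
end

section
/- For every n ≥ 1: (a) every T ∈ T_n^e satisfies fr(T) ≤ n; (b) the configuration T_{n,max} := {(j,j) : 1 ≤ j ≤ n} ∪ {(j, 2n+1−j) : 1 ≤ j ≤ n} belongs to T_n^e and satisfies b(T_{n,max}) = 0, r(T_{n,max}) = n−1 and g(T_{n,max}) = 0, hence max(T_{n,max}) = n−1; consequently the polynomial Σ_{T ∈ T_n^e} 2^{fr(T)−1−max(T)} x^{max(T)} has degree exactly n−1. -/
open scoped Classical

namespace SymDellac

theorem mem_TneF {n : ℕ} {T : Finset (ℕ × ℕ)} : T ∈ TneF n ↔ IsTne n T := by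
  unfold TneF
  rw [Finset.mem_filter, Finset.mem_powerset, and_iff_right_iff_imp]
  intro h p hp
  obtain ⟨h1, h2, h3, h4, -⟩ := h.1 p hp
  simp only [Finset.mem_product, Finset.mem_Icc]
  exact ⟨⟨h1, h2⟩, h3, h4⟩

namespace IsTne

variable {n : ℕ} {T : Finset (ℕ × ℕ)}

theorem exists_row (h : IsTne n T) {i : ℕ} (h1 : 1 ≤ i) (h2 : i ≤ 2 * n) : ∃ p ∈ T, p.2 = i := by
  have hc := h.2.1 i (Finset.mem_Icc.2 ⟨h1, h2⟩)
  obtain ⟨p, hp⟩ := Finset.card_pos.1 (by omega : 0 < (T.filter (fun p => p.2 = i)).card)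
  exact ⟨p, Finset.mem_filter.1 hp⟩

theorem eq_of_row_eq (h : IsTne n T) {p q : ℕ × ℕ} (hp : p ∈ T) (hq : q ∈ T) (hpq : p.2 = q.2) :
    p = q := by
  obtain ⟨-, -, h1, h2, -⟩ := h.1 q hq
  have hc := h.2.1 q.2 (Finset.mem_Icc.2 ⟨h1, h2⟩)
  exact Finset.card_le_one.1 hc.le p (Finset.mem_filter.2 ⟨hp, hpq⟩) q
    (Finset.mem_filter.2 ⟨hq, rfl⟩)

theorem rowPt_eq (h : IsTne n T) {p : ℕ × ℕ} (hp : p ∈ T) : rowPt T p.2 = p :=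
  h.eq_of_row_eq (rowPt_spec ⟨p, hp, rfl⟩).1 hp (rowPt_spec ⟨p, hp, rfl⟩).2

theorem upRow_eq (h : IsTne n T) {p : ℕ × ℕ} (hp : p ∈ T) (hu : IsUpper T p) :
    upRow T p.1 = p.2 := by
  refine IsGreatest.csSup_eq ⟨hp, fun i hi => ?_⟩
  by_contra! hlt
  obtain ⟨q, hq, hqc, hqp⟩ := hu
  obtain ⟨h1, h2, -⟩ := h.1 p hp
  have hc := h.2.2 p.1 (Finset.mem_Icc.2 ⟨h1, h2⟩)
  have hi' : (p.1, i) ∈ T := hi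
  have : 2 < (T.filter (fun r => r.1 = p.1)).card := by
    refine Finset.two_lt_card.2 ⟨q, ?_, p, ?_, (p.1, i), ?_, ?_, ?_, ?_⟩
    · exact Finset.mem_filter.2 ⟨hq, hqc⟩
    · exact Finset.mem_filter.2 ⟨hp, rfl⟩
    · exact Finset.mem_filter.2 ⟨hi', rfl⟩
    · exact fun e => hqp.ne (congrArg Prod.snd e)
    · exact fun e => (hqp.trans hlt).ne (congrArg Prod.snd e)
    · exact fun e => hlt.ne (congrArg Prod.snd e)
  omega

theorem frE_le (h : IsTne n T) : frE n T ≤ n := by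
  have hcard : (Finset.Icc (n + 1) (2 * n)).card = n := by
    rw [Nat.card_Icc]
    omega
  rw [← hcard]
  refine Finset.card_le_card_of_injOn Prod.snd (fun p hp => ?_) (fun p hp q hq hpq => ?_)
  · obtain ⟨hpT, hf⟩ := Finset.mem_filter.1 hp
    obtain ⟨-, h2, -, h4, -⟩ := h.1 p hpT
    exact Finset.mem_coe.2 (Finset.mem_Icc.2 ⟨by omega, h4⟩)
  · exact h.eq_of_row_eq (Finset.mem_filter.1 hp).1 (Finset.mem_filter.1 hq).1 hpq

/-! ### Paths and records -/

theorem stepE_spec (h : IsTne n T) {p : ℕ × ℕ} (hp : p ∈ T) (hn : p.1 ≠ n) :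
    stepE n T p ∈ T ∧ (stepE n T p).2 = if IsUpper T p then 2 * n - p.1 else p.1 := by
  obtain ⟨h1, h2, -⟩ := h.1 p hp
  unfold stepE
  rw [if_neg hn]
  split_ifs
  · exact rowPt_spec (h.exists_row (by omega) (by omega))
  · exact rowPt_spec (h.exists_row (by omega) (by omega))

theorem stepE_mem (h : IsTne n T) {p : ℕ × ℕ} (hp : p ∈ T) : stepE n T p ∈ T := by
  by_cases hn : p.1 = n
  · unfold stepE
    rwa [if_pos hn]
  · exact (h.stepE_spec hp hn).1

theorem pathE_mem (h : IsTne n T) {i : ℕ} (h1 : 1 ≤ i) (h2 : i ≤ 2 * n) (k : ℕ) :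
    pathE n T i k ∈ T := by
  induction k with
  | zero => exact (rowPt_spec (h.exists_row h1 h2)).1
  | succ k ih =>
    unfold pathE
    rw [Function.iterate_succ_apply']
    exact h.stepE_mem ih

theorem recSetE_subset (h : IsTne n T) {i : ℕ} (h1 : 1 ≤ i) (h2 : i ≤ 2 * n) :
    recSetE n T i ⊆ T := by
  rintro _ ⟨k, rfl, -⟩
  exact h.pathE_mem h1 h2 k

/-- A record other than the starting point of its path is free. -/
theorem free_of_mem_recSetE (h : IsTne n T) {i : ℕ} (h1 : 1 ≤ i) (h2 : i ≤ 2 * n) {p : ℕ × ℕ}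
    (hp : p ∈ recSetE n T i) (hne : p ≠ rowPt T i) : 2 * n + 1 ≤ p.2 + p.1 := by
  obtain ⟨k, rfl, hrec⟩ := hp
  obtain _ | k := k
  · exact absurd rfl hne
  have hlt := hrec k k.lt_succ_self
  have hq := h.pathE_mem h1 h2 k
  obtain ⟨-, hjn, -, -, hdiag⟩ := h.1 _ (h.pathE_mem h1 h2 (k + 1))
  have hrow := (h.stepE_spec hq (by omega)).2
  have hsucc : pathE n T i (k + 1) = stepE n T (pathE n T i k) :=
    Function.iterate_succ_apply' _ _ _
  rw [← hsucc] at hrow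
  split_ifs at hrow <;> omega

/-! ### Roots of records -/

/-- The root sequence walks the path backwards through columns before `j`. -/
theorem rStep_stepE (h : IsTne n T) {j : ℕ} (hj : j ≤ n) {p : ℕ × ℕ} (hp : p ∈ T)
    (hpj : p.1 < j) : rStep (2 * n) j T (stepE n T p).2 = p.2 := by
  obtain ⟨h1, -⟩ := h.1 p hp
  rw [(h.stepE_spec hp (by omega)).2]
  unfold rStep
  by_cases hu : IsUpper T p
  · rw [if_pos hu, if_neg (by omega), if_pos (by omega),
      (by omega : 2 * n - (2 * n - p.1) = p.1)]
    exact h.upRow_eq hp hu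
  · rw [if_neg hu, if_neg (by omega), if_neg (by omega)]
    exact IsLeast.csInf_eq ⟨hp, fun i hi => not_lt.1 fun hlt => hu ⟨(p.1, i), hi, rfl, hlt⟩⟩

theorem rStep_iterate_pathE (h : IsTne n T) {i j : ℕ} (h1 : 1 ≤ i) (h2 : i ≤ 2 * n) (hj : j ≤ n)
    (k : ℕ) (hk : ∀ k' < k, (pathE n T i k').1 < j) :
    (rStep (2 * n) j T)^[k] (pathE n T i k).2 = i := by
  induction k with
  | zero => exact (rowPt_spec (h.exists_row h1 h2)).2
  | succ k ih =>
    have hsucc : pathE n T i (k + 1) = stepE n T (pathE n T i k) :=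
      Function.iterate_succ_apply' _ _ _
    rw [Function.iterate_succ_apply, hsucc,
      h.rStep_stepE hj (h.pathE_mem h1 h2 k) (hk k k.lt_succ_self)]
    exact ih fun k' hk' => hk k' (hk'.trans k.lt_succ_self)

end IsTne

theorem rootVal_eq_of_iterate {R j i v N : ℕ} {T : Finset (ℕ × ℕ)}
    (hN : (rStep R j T)^[N] i = v) (hv : rStep R j T v = v) : rootVal R j T i = v := by
  have hconst : ∀ k ≥ N, (rStep R j T)^[k] i = v := by
    intro k hk
    obtain ⟨m, rfl⟩ := Nat.exists_eq_add_of_le' hk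
    rw [Function.iterate_add_apply, hN, Function.iterate_fixed hv]
  have hex : ∃ v, ∃ N, ∀ k ≥ N, (rStep R j T)^[k] i = v := ⟨v, N, hconst⟩
  unfold rootVal
  rw [dif_pos hex]
  obtain ⟨M, hM⟩ := hex.choose_spec
  rw [← hM (max M N) (le_max_left _ _), hconst _ (le_max_right _ _)]

namespace IsTne

variable {n : ℕ} {T : Finset (ℕ × ℕ)}

/-- Records of the paths starting at rows `n` and `2n` have root `n` and `2n` respectively. -/
theorem rootVal_of_mem_recSetE (h : IsTne n T) (hn : 1 ≤ n) {i : ℕ} (hi : i = n ∨ i = 2 * n)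
    {p : ℕ × ℕ} (hp : p ∈ recSetE n T i) : rootVal (2 * n) p.1 T p.2 = i := by
  obtain ⟨k, rfl, hrec⟩ := hp
  have hjn := (h.1 _ (h.pathE_mem (by omega : 1 ≤ i) (by omega) k)).2.1
  refine rootVal_eq_of_iterate (h.rStep_iterate_pathE (by omega) (by omega) hjn k hrec) ?_
  unfold rStep
  rw [if_pos (by omega)]

theorem disjoint_recSetE (h : IsTne n T) (hn : 1 ≤ n) :
    Disjoint (recSetE n T n) (recSetE n T (2 * n)) := by
  refine Set.disjoint_left.2 fun p hB hR => ?_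
  have := h.rootVal_of_mem_recSetE hn (Or.inl rfl) hB
  have := h.rootVal_of_mem_recSetE hn (Or.inr rfl) hR
  omega

end IsTne

theorem eq_of_mem_recSetE {n i : ℕ} {T : Finset (ℕ × ℕ)} {p q : ℕ × ℕ} (hp : p ∈ recSetE n T i)
    (hq : q ∈ recSetE n T i) (hpq : p.1 = q.1) : p = q := by
  obtain ⟨k, rfl, hk⟩ := hp
  obtain ⟨l, rfl, hl⟩ := hq
  rcases lt_trichotomy k l with hkl | rfl | hkl
  · exact absurd hpq (hl k hkl).ne
  · rfl
  · exact absurd hpq.symm (hk l hkl).ne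

theorem rowPt_mem_recSetE (n i : ℕ) (T : Finset (ℕ × ℕ)) : rowPt T i ∈ recSetE n T i :=
  ⟨0, rfl, fun _ hk => absurd hk (Nat.not_lt_zero _)⟩

theorem disjoint_recSetE_GsetE (n : ℕ) (T : Finset (ℕ × ℕ)) :
    Disjoint (recSetE n T n) (GsetE n T) := by
  refine Set.disjoint_left.2 fun p hB hG => ?_
  obtain ⟨-, -, ⟨q, -, hqc, hqp, hqB⟩, -⟩ := hG
  exact hqp (eq_of_mem_recSetE hqB hB hqc)

namespace IsTne

variable {n : ℕ} {T : Finset (ℕ × ℕ)}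

theorem disjoint_recSetE_two_mul_GsetE (h : IsTne n T) (hn : 1 ≤ n) :
    Disjoint (recSetE n T (2 * n)) (GsetE n T) := by
  refine Set.disjoint_left.2 fun p hR hG => ?_
  have := h.rootVal_of_mem_recSetE hn (Or.inr rfl) hR
  have := hG.2.2.2
  have := (h.1 p hG.1).2.1
  omega

/-- `max(T) < fr(T)`: the points counted by `b`, `r`, `g` are free, as is the point of row `2n`. -/
theorem maxStat_lt_frE (h : IsTne n T) (hn : 1 ≤ n) : maxStat n T + 1 ≤ frE n T := by
  have hBT : recSetE n T n ⊆ T := h.recSetE_subset hn (by omega)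
  have hRT : recSetE n T (2 * n) ⊆ T := h.recSetE_subset (by omega) le_rfl
  have hGT : GsetE n T ⊆ T := fun p hp => hp.1
  have hBfin := T.finite_toSet.subset hBT
  have hRfin := T.finite_toSet.subset hRT
  have hGfin := T.finite_toSet.subset hGT
  have hb : bStat n T = (recSetE n T n \ {rowPt T n}).ncard :=
    (Set.ncard_sdiff_singleton_of_mem (rowPt_mem_recSetE n n T)).symm
  have hr : rStat n T + 1 = (recSetE n T (2 * n)).ncard :=
    Nat.sub_add_cancel ((Set.ncard_pos hRfin).2 ⟨_, rowPt_mem_recSetE n (2 * n) T⟩)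
  have hB'fin := hBfin.subset (Set.sdiff_subset (t := {rowPt T n}))
  have hBR : Disjoint (recSetE n T n \ {rowPt T n}) (recSetE n T (2 * n)) :=
    (h.disjoint_recSetE hn).mono_left Set.sdiff_subset
  have hBRG : Disjoint (recSetE n T n \ {rowPt T n} ∪ recSetE n T (2 * n)) (GsetE n T) :=
    Set.disjoint_union_left.2 ⟨(disjoint_recSetE_GsetE n T).mono_left Set.sdiff_subset,
      h.disjoint_recSetE_two_mul_GsetE hn⟩
  have hsub : recSetE n T n \ {rowPt T n} ∪ recSetE n T (2 * n) ∪ GsetE n T ⊆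
      (T.filter (fun p => 2 * n + 1 ≤ p.2 + p.1) : Finset (ℕ × ℕ)) := by
    rintro p ((⟨hp, hne⟩ | hp) | hp) <;> refine Finset.mem_coe.2 (Finset.mem_filter.2 ⟨?_, ?_⟩)
    · exact hBT hp
    · exact h.free_of_mem_recSetE hn (by omega) hp hne
    · exact hRT hp
    · by_cases hne : p = rowPt T (2 * n)
      · have hrow := (rowPt_spec (h.exists_row (by omega : 1 ≤ 2 * n) le_rfl)).2
        rw [← hne] at hrow
        have := (h.1 p (hRT hp)).1
        omega
      · exact h.free_of_mem_recSetE (by omega) le_rfl hp hne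
    · exact hp.1
    · exact hp.2.1
  have hcard := Set.ncard_le_ncard hsub (Finset.finite_toSet _)
  rw [Set.ncard_coe_finset, Set.ncard_union_eq hBRG (hB'fin.union hRfin) hGfin,
    Set.ncard_union_eq hBR hB'fin hRfin, ← hb, ← hr] at hcard
  unfold maxStat frE gStat
  omega

theorem maxStat_le (h : IsTne n T) (hn : 1 ≤ n) : maxStat n T ≤ n - 1 := by
  have := h.maxStat_lt_frE hn
  have := h.frE_le
  omega

end IsTne

/-! ### The configuration `T_{n,max}` -/

theorem mem_Tmax {n : ℕ} {p : ℕ × ℕ} :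
    p ∈ Tmax n ↔ 1 ≤ p.1 ∧ p.1 ≤ n ∧ (p.2 = p.1 ∨ p.2 = 2 * n + 1 - p.1) := by
  obtain ⟨a, b⟩ := p
  simp only [Tmax, Finset.mem_union, Finset.mem_image, Finset.mem_Icc, Prod.mk.injEq]
  constructor
  · rintro (⟨j, hj, rfl, rfl⟩ | ⟨j, hj, rfl, rfl⟩)
    · exact ⟨hj.1, hj.2, Or.inl rfl⟩
    · exact ⟨hj.1, hj.2, Or.inr rfl⟩
  · rintro ⟨h1, h2, h3 | h3⟩
    · exact Or.inl ⟨a, ⟨h1, h2⟩, rfl, h3.symm⟩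
    · exact Or.inr ⟨a, ⟨h1, h2⟩, rfl, h3.symm⟩

theorem isTne_Tmax (n : ℕ) : IsTne n (Tmax n) := by
  refine ⟨fun p hp => ?_, fun i hi => ?_, fun j hj => ?_⟩
  · have := mem_Tmax.1 hp
    omega
  · rw [Finset.mem_Icc] at hi
    rw [Finset.card_eq_one]
    refine ⟨(if i ≤ n then i else 2 * n + 1 - i, i), Finset.ext fun ⟨a, b⟩ => ?_⟩
    rw [Finset.mem_filter, mem_Tmax, Finset.mem_singleton, Prod.mk.injEq]
    dsimp only
    split_ifs <;> omega
  · rw [Finset.mem_Icc] at hj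
    rw [Finset.card_eq_two]
    refine ⟨(j, j), (j, 2 * n + 1 - j), fun e => ?_, Finset.ext fun ⟨a, b⟩ => ?_⟩
    · have : j = 2 * n + 1 - j := congrArg Prod.snd e
      omega
    · rw [Finset.mem_filter, mem_Tmax, Finset.mem_insert, Finset.mem_singleton, Prod.mk.injEq,
        Prod.mk.injEq]
      dsimp only
      omega

theorem pathE_Tmax {n k : ℕ} (hk : k < n) :
    pathE n (Tmax n) (2 * n) k = (k + 1, 2 * n - k) := by
  have hT := isTne_Tmax n
  induction k with
  | zero => exact hT.rowPt_eq (p := (1, 2 * n)) (mem_Tmax.2 (by dsimp only; omega))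
  | succ k ih =>
    unfold pathE at ih ⊢
    have hu : IsUpper (Tmax n) (k + 1, 2 * n - k) :=
      ⟨(k + 1, k + 1), mem_Tmax.2 (by dsimp only; omega), rfl, by dsimp only; omega⟩
    rw [Function.iterate_succ_apply', ih (by omega)]
    unfold stepE
    rw [if_neg (by dsimp only; omega), if_pos hu]
    exact hT.rowPt_eq (p := (k + 1 + 1, 2 * n - (k + 1))) (mem_Tmax.2 (by dsimp only; omega))

theorem le_rStat_Tmax {n : ℕ} (hn : 1 ≤ n) : n - 1 ≤ rStat n (Tmax n) := by
  have hfin : (recSetE n (Tmax n) (2 * n)).Finite :=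
    (Tmax n).finite_toSet.subset ((isTne_Tmax n).recSetE_subset (by omega) le_rfl)
  have hsub : (↑((Finset.range n).image (fun k => (k + 1, 2 * n - k))) : Set (ℕ × ℕ)) ⊆
      recSetE n (Tmax n) (2 * n) := by
    intro p hp
    obtain ⟨k, hk, rfl⟩ := Finset.mem_image.1 (Finset.mem_coe.1 hp)
    have hkn := Finset.mem_range.1 hk
    refine ⟨k, pathE_Tmax hkn, fun k' hk' => ?_⟩
    rw [pathE_Tmax (hk'.trans hkn)]
    exact Nat.succ_lt_succ hk'
  have hcard := Set.ncard_le_ncard hsub hfin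
  rw [Set.ncard_coe_finset, Finset.card_image_of_injective _
    fun a b hab => Nat.succ_injective (congrArg Prod.fst hab), Finset.card_range] at hcard
  exact Nat.sub_le_sub_right hcard 1

theorem maxStat_Tmax {n : ℕ} (hn : 1 ≤ n) :
    bStat n (Tmax n) = 0 ∧ rStat n (Tmax n) = n - 1 ∧ gStat n (Tmax n) = 0 ∧
      maxStat n (Tmax n) = n - 1 := by
  have hle := (isTne_Tmax n).maxStat_le hn
  have hr := le_rStat_Tmax hn
  unfold maxStat at hle ⊢
  omega

/-- `fr(T) ≤ n` for all `T ∈ T_n^e`; the configuration `T_{n,max}` belongs to `T_n^e`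
with `b = 0`, `r = n-1`, `g = 0`, hence `max(T_{n,max}) = n-1`; consequently the
polynomial `Σ_{T ∈ T_n^e} 2^{fr(T)-1-max(T)} x^{max(T)}` has degree exactly `n-1`. -/
theorem statement15 (n : ℕ) (hn : 1 ≤ n) :
    (∀ T ∈ TneF n, frE n T ≤ n) ∧
    Tmax n ∈ TneF n ∧
    bStat n (Tmax n) = 0 ∧ rStat n (Tmax n) = n - 1 ∧ gStat n (Tmax n) = 0 ∧
    maxStat n (Tmax n) = n - 1 ∧
    (∑ T ∈ TneF n,
        Polynomial.C ((2 : ℚ) ^ (frE n T - 1 - maxStat n T)) *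
          Polynomial.X ^ (maxStat n T)).natDegree = n - 1 := by
  obtain ⟨hb, hr, hg, hmax⟩ := maxStat_Tmax hn
  have hmem : Tmax n ∈ TneF n := mem_TneF.2 (isTne_Tmax n)
  refine ⟨fun T hT => (mem_TneF.1 hT).frE_le, hmem, hb, hr, hg, hmax, le_antisymm ?_ ?_⟩
  · exact Polynomial.natDegree_sum_le_of_forall_le _ _ fun T hT =>
      (Polynomial.natDegree_C_mul_X_pow_le _ _).trans ((mem_TneF.1 hT).maxStat_le hn)
  · refine Polynomial.le_natDegree_of_ne_zero (ne_of_gt ?_)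
    rw [Polynomial.finsetSum_coeff]
    refine Finset.sum_pos' (fun T _ => ?_) ⟨Tmax n, hmem, ?_⟩
    · rw [Polynomial.coeff_C_mul_X_pow]
      split_ifs <;> positivity
    · rw [Polynomial.coeff_C_mul_X_pow, if_pos hmax.symm]
      positivity

end SymDellac
end
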